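/- (Schauder estimate) Let p ∈ (1, ∞) and let u belong to the Schwartz space of rapidly decaying infinitely differentiable functions on ℝⁿ. Then for all 1 ≤ j₁, j₂ ≤ n, ‖∂²u/∂x_{j₁}∂x_{j₂}‖_p ≤ C_{p,n} ‖Δu‖_p, where Δ is the Laplacian and C_{p,n} is independent of u. -/

import Mathlib

open MeasureTheory ENNReal Real

/-- A twice differentiable Bellman function on the plane. The fields `fst`, `snd`, `fstFst`,
`fstSnd`, `sndSnd` are its partial derivatives of order one and two, its Hessian dominates
`a x² + a⁻¹ y²` for some positive `a` at every point, and it grows at most like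
`|z|ᵖ + |w|^q`, up to a small quadratic error. -/
structure BellmanFunction (p q C δ : ℝ) where
  toFun : ℝ → ℝ → ℝ
  fst : ℝ → ℝ → ℝ
  snd : ℝ → ℝ → ℝ
  fstFst : ℝ → ℝ → ℝ
  fstSnd : ℝ → ℝ → ℝ
  sndSnd : ℝ → ℝ → ℝ
  continuous_toFun : Continuous fun z : ℝ × ℝ => toFun z.1 z.2
  continuous_fst : Continuous fun z : ℝ × ℝ => fst z.1 z.2
  continuous_snd : Continuous fun z : ℝ × ℝ => snd z.1 z.2
  continuous_fstFst : Continuous fun z : ℝ × ℝ => fstFst z.1 z.2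
  continuous_fstSnd : Continuous fun z : ℝ × ℝ => fstSnd z.1 z.2
  continuous_sndSnd : Continuous fun z : ℝ × ℝ => sndSnd z.1 z.2
  hasDerivAt_toFun : ∀ {f g : ℝ → ℝ} {f' g' t : ℝ}, HasDerivAt f f' t → HasDerivAt g g' t →
    HasDerivAt (fun t => toFun (f t) (g t)) (fst (f t) (g t) * f' + snd (f t) (g t) * g') t
  hasDerivAt_fst : ∀ {f g : ℝ → ℝ} {f' g' t : ℝ}, HasDerivAt f f' t → HasDerivAt g g' t →
    HasDerivAt (fun t => fst (f t) (g t)) (fstFst (f t) (g t) * f' + fstSnd (f t) (g t) * g') t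
  hasDerivAt_snd : ∀ {f g : ℝ → ℝ} {f' g' t : ℝ}, HasDerivAt f f' t → HasDerivAt g g' t →
    HasDerivAt (fun t => snd (f t) (g t)) (fstSnd (f t) (g t) * f' + sndSnd (f t) (g t) * g') t
  nonneg : ∀ z w, 0 ≤ toFun z w
  le : ∀ z w, toFun z w ≤ C * (|z| ^ p + |w| ^ q) + δ * (z ^ 2 + w ^ 2)
  hessian : ∀ z w, ∃ a > 0, ∀ x y, a * x ^ 2 + a⁻¹ * y ^ 2 ≤
    fstFst z w * x ^ 2 + 2 * fstSnd z w * (x * y) + sndSnd z w * y ^ 2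

/-- Exchanging the two variables of a Bellman function. -/
def BellmanFunction.swap {p q C δ : ℝ} (B : BellmanFunction p q C δ) :
    BellmanFunction q p C δ where
  toFun z w := B.toFun w z
  fst z w := B.snd w z
  snd z w := B.fst w z
  fstFst z w := B.sndSnd w z
  fstSnd z w := B.fstSnd w z
  sndSnd z w := B.fstFst w z
  continuous_toFun := B.continuous_toFun.comp continuous_swap
  continuous_fst := B.continuous_snd.comp continuous_swap
  continuous_snd := B.continuous_fst.comp continuous_swap
  continuous_fstFst := B.continuous_sndSnd.comp continuous_swap
  continuous_fstSnd := B.continuous_fstSnd.comp continuous_swap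
  continuous_sndSnd := B.continuous_fstFst.comp continuous_swap
  hasDerivAt_toFun hf hg := by simpa only [add_comm] using B.hasDerivAt_toFun hg hf
  hasDerivAt_fst hf hg := by simpa only [add_comm] using B.hasDerivAt_snd hg hf
  hasDerivAt_snd hf hg := by simpa only [add_comm] using B.hasDerivAt_fst hg hf
  nonneg z w := B.nonneg w z
  le z w := by linarith [B.le w z]
  hessian z w := by
    obtain ⟨a, ha, h⟩ := B.hessian w z
    refine ⟨a⁻¹, inv_pos.2 ha, fun x y => ?_⟩
    rw [inv_inv]
    linarith [h y x]

set_option maxHeartbeats 1000000 in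
/-- The Hessian bound, as an algebraic inequality in `X = z² + ε`, `Y = w² + ε`, `m = X ^ r`,
`s = m + Y`, `σ = s ^ a` and `τ = Y ^ (-a)`. -/
lemma bellman_hessian_algebra {r a K z w X Y m s σ τ : ℝ} (hr : 1 ≤ r) (ha : 1 - 2 * a = 1 / r)
    (hK : K = (2 + 4 * (1 + r) ^ 2) * r) (hX : 0 < X) (hY : 0 < Y) (hs : 0 < s)
    (hσ : 0 < σ) (hτ : σ⁻¹ ≤ τ) (hm : 0 < m) (hzX : z ^ 2 ≤ X) (hwY : w ^ 2 ≤ Y) (hms : m ≤ s)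
    (hYs : Y ≤ s) (hXs : X * σ ^ 2 ≤ s) (x y : ℝ) :
    σ * x ^ 2 + σ⁻¹ * y ^ 2 ≤
      (2 * σ + 10 * a * r * z ^ 2 * (σ / s) * (m / X)
        + 4 * a * r ^ 2 * (a - 1) * z ^ 4 * (σ / s / s) * (m / X) ^ 2
        + 4 * a * r * (r - 1) * z ^ 4 * (σ / s) * (m / X / X)) * x ^ 2
      + 2 * (4 * a * z * w * (σ / s) + 4 * a * r * (a - 1) * z ^ 3 * w * (σ / s / s) * (m / X))
        * (x * y)
      + (2 * K * (1 - a) * (τ - 2 * a * w ^ 2 * (τ / Y)) + 2 * a * z ^ 2 * (σ / s)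
        + 4 * a * (a - 1) * z ^ 2 * w ^ 2 * (σ / s / s)) * y ^ 2 := by
  have hr0 : 0 < r := by linarith
  have hr1 : 1 / r ≤ 1 := by rw [div_le_one hr0]; exact hr
  have hr2 : 0 < 1 / r := by positivity
  have ha0 : 0 ≤ a := by linarith
  have ha1 : a < 1 / 2 := by linarith
  have hτ0 : 0 < τ := lt_of_lt_of_le (inv_pos.2 hσ) hτ
  set u := z ^ 2 / X with hu
  set v := m / s with hv
  have hu0 : 0 ≤ u := by positivity
  have hu1 : u ≤ 1 := by rw [hu, div_le_one hX]; exact hzX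
  have hv0 : 0 < v := by positivity
  have hv1 : v ≤ 1 := by rw [hv, div_le_one hs]; exact hms
  have e11 : 2 * σ ≤ 2 * σ + 10 * a * r * z ^ 2 * (σ / s) * (m / X)
        + 4 * a * r ^ 2 * (a - 1) * z ^ 4 * (σ / s / s) * (m / X) ^ 2
        + 4 * a * r * (r - 1) * z ^ 4 * (σ / s) * (m / X / X) := by
    have : 10 * a * r * z ^ 2 * (σ / s) * (m / X)
        + 4 * a * r ^ 2 * (a - 1) * z ^ 4 * (σ / s / s) * (m / X) ^ 2
        + 4 * a * r * (r - 1) * z ^ 4 * (σ / s) * (m / X / X)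
        = a * r * σ * v * u * (10 + 4 * (r - 1) * u - 4 * r * (1 - a) * (u * v)) := by
      rw [hu, hv]; field_simp; ring
    have h1 : u * v ≤ u := by nlinarith
    have h2 : 4 * r * (1 - a) * (u * v) ≤ 4 * r * u := by
      calc 4 * r * (1 - a) * (u * v) ≤ 4 * r * 1 * u := by
            gcongr
            linarith
        _ = _ := by ring
    have h3 : 0 ≤ 10 + 4 * (r - 1) * u - 4 * r * (1 - a) * (u * v) := by nlinarith
    have : 0 ≤ a * r * σ * v * u * (10 + 4 * (r - 1) * u - 4 * r * (1 - a) * (u * v)) := by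
      positivity
    linarith
  have hzw : |z * w * (σ / s)| ≤ 1 := by
    apply abs_le_one_iff_mul_self_le_one.2
    have : z * w * (σ / s) * (z * w * (σ / s)) = z ^ 2 * w ^ 2 * σ ^ 2 / s ^ 2 := by
      field_simp
    rw [this, div_le_one (by positivity)]
    calc z ^ 2 * w ^ 2 * σ ^ 2 ≤ X * s * σ ^ 2 := by gcongr; linarith
      _ = (X * σ ^ 2) * s := by ring
      _ ≤ s * s := by gcongr
      _ = s ^ 2 := by ring
  have e12 : |4 * a * z * w * (σ / s) + 4 * a * r * (a - 1) * z ^ 3 * w * (σ / s / s) * (m / X)|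
      ≤ 2 * (1 + r) := by
    have : 4 * a * z * w * (σ / s) + 4 * a * r * (a - 1) * z ^ 3 * w * (σ / s / s) * (m / X)
        = 4 * a * (1 - r * (1 - a) * (u * v)) * (z * w * (σ / s)) := by
      rw [hu, hv]; field_simp; ring
    rw [this, abs_mul]
    have huv0 : 0 ≤ u * v := by positivity
    have huv : u * v ≤ 1 := by nlinarith
    have h1 : r * (1 - a) * (u * v) ≤ r * 1 * 1 := by
      gcongr
      linarith
    have h2 : 0 ≤ r * (1 - a) * (u * v) := by
      have : 0 ≤ 1 - a := by linarith
      positivity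
    have h3 : |4 * a * (1 - r * (1 - a) * (u * v))| ≤ 2 * (1 + r) := by
      rw [abs_mul, abs_of_nonneg (by positivity)]
      have : |1 - r * (1 - a) * (u * v)| ≤ 1 + r := by
        rw [abs_le]; constructor <;> linarith
      gcongr
      linarith
    calc _ ≤ 2 * (1 + r) * 1 := by gcongr
      _ = _ := by ring
  have e22 : (1 + 4 * (1 + r) ^ 2) * σ⁻¹ ≤
      2 * K * (1 - a) * (τ - 2 * a * w ^ 2 * (τ / Y)) + 2 * a * z ^ 2 * (σ / s)
        + 4 * a * (a - 1) * z ^ 2 * w ^ 2 * (σ / s / s) := by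
    have hK0 : 0 < K := by rw [hK]; positivity
    have h1 : (1 - 2 * a) * τ ≤ τ - 2 * a * w ^ 2 * (τ / Y) := by
      have : w ^ 2 * (τ / Y) ≤ τ := by
        rw [mul_div_assoc', div_le_iff₀ hY, mul_comm]
        gcongr
      nlinarith
    have h2 : (2 + 4 * (1 + r) ^ 2) * σ⁻¹ ≤ 2 * K * (1 - a) * (τ - 2 * a * w ^ 2 * (τ / Y)) := by
      calc (2 + 4 * (1 + r) ^ 2) * σ⁻¹ ≤ (2 + 4 * (1 + r) ^ 2) * τ := by gcongr
        _ = K * (1 * ((1 - 2 * a) * τ)) := by rw [ha, hK]; field_simp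
        _ ≤ K * ((2 * (1 - a)) * ((1 - 2 * a) * τ)) := by
          gcongr
          · rw [ha]; positivity
          · linarith
        _ = 2 * K * (1 - a) * ((1 - 2 * a) * τ) := by ring
        _ ≤ _ := by
          have : 0 ≤ 1 - a := by linarith
          gcongr
    have h3 : z ^ 2 * w ^ 2 * (σ / s / s) ≤ σ⁻¹ := by
      have : z ^ 2 * w ^ 2 * (σ / s / s) = z ^ 2 * w ^ 2 * σ / s ^ 2 := by field_simp
      rw [this, div_le_iff₀ (by positivity)]
      calc z ^ 2 * w ^ 2 * σ ≤ X * s * σ := by gcongr; linarith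
        _ = σ⁻¹ * ((X * σ ^ 2) * s) := by field_simp
        _ ≤ σ⁻¹ * (s * s) := by gcongr
        _ = _ := by ring
    have h4 : 4 * a * (1 - a) * (z ^ 2 * w ^ 2 * (σ / s / s)) ≤ 1 * σ⁻¹ := by
      have : 4 * a * (1 - a) ≤ 1 := by nlinarith [sq_nonneg (2 * a - 1)]
      gcongr
    have h5 : 0 ≤ 2 * a * z ^ 2 * (σ / s) := by positivity
    linarith
  have hxy : 4 * (1 + r) * |x * y| ≤ σ * x ^ 2 + 4 * (1 + r) ^ 2 * σ⁻¹ * y ^ 2 := by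
    have : 0 ≤ σ⁻¹ * (σ * |x| - 2 * (1 + r) * |y|) ^ 2 := by positivity
    have e : σ⁻¹ * (σ * |x| - 2 * (1 + r) * |y|) ^ 2
      = σ * x ^ 2 + 4 * (1 + r) ^ 2 * σ⁻¹ * y ^ 2 - 4 * (1 + r) * |x * y| := by
      rw [abs_mul, ← sq_abs x, ← sq_abs y]; field_simp; ring
    linarith
  set b11 := 2 * σ + 10 * a * r * z ^ 2 * (σ / s) * (m / X)
        + 4 * a * r ^ 2 * (a - 1) * z ^ 4 * (σ / s / s) * (m / X) ^ 2
        + 4 * a * r * (r - 1) * z ^ 4 * (σ / s) * (m / X / X)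
  set b12 := 4 * a * z * w * (σ / s) + 4 * a * r * (a - 1) * z ^ 3 * w * (σ / s / s) * (m / X)
  set b22 := 2 * K * (1 - a) * (τ - 2 * a * w ^ 2 * (τ / Y)) + 2 * a * z ^ 2 * (σ / s)
        + 4 * a * (a - 1) * z ^ 2 * w ^ 2 * (σ / s / s)
  have h12 : - (2 * (1 + r) * |x * y|) ≤ b12 * (x * y) := by
    have := neg_abs_le (b12 * (x * y))
    rw [abs_mul] at this
    have h : |b12| * |x * y| ≤ 2 * (1 + r) * |x * y| := by gcongr
    linarith
  have h11 := mul_le_mul_of_nonneg_right e11 (sq_nonneg x)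
  have h22 := mul_le_mul_of_nonneg_right e22 (sq_nonneg y)
  linarith

/-- The growth bound for the explicit Bellman function. -/
lemma bellman_growth {r a K ε δ : ℝ} (hr : 1 ≤ r) (ha : 1 - 2 * a = 1 / r) (hK0 : 0 < K)
    (hε : 0 < ε) (hδ : 0 < δ) (hεδ : r = 1 ∨ 2 ^ r * ε ^ (r * a) + ε ^ a ≤ δ) (z w : ℝ) :
    K * ((w ^ 2 + ε) ^ (1 - a) - ε ^ (1 - a)) + z ^ 2 * ((z ^ 2 + ε) ^ r + (w ^ 2 + ε)) ^ a ≤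
      (K + 2 ^ r + 2) * (|z| ^ (r + 1) + |w| ^ (1 + 1 / r)) + δ * (z ^ 2 + w ^ 2) := by
  have hr0 : 0 < r := by linarith
  have hr1 : 1 / r ≤ 1 := by rw [div_le_one hr0]; exact hr
  have hr2 : 0 < 1 / r := by positivity
  have ha0 : 0 ≤ a := by linarith
  have ha1 : a < 1 / 2 := by linarith
  have hra : 2 * (r * a) = r - 1 := by
    have : r * (1 - 2 * a) = 1 := by rw [ha]; field_simp
    linarith
  have hX : ∀ z : ℝ, 0 < z ^ 2 + ε := fun z => by positivity
  have hsq : ∀ (x c : ℝ), (x ^ 2) ^ c = |x| ^ (2 * c) := fun x c => by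
    rw [← sq_abs, ← Real.rpow_natCast, ← Real.rpow_mul (abs_nonneg _)]; norm_num
  have h1 : (w ^ 2 + ε) ^ (1 - a) - ε ^ (1 - a) ≤ |w| ^ (1 + 1 / r) := by
    have := rpow_add_le_add_rpow (sq_nonneg w) hε.le
      (by linarith : 0 ≤ 1 - a) (by linarith : 1 - a ≤ 1)
    rw [hsq, show 2 * (1 - a) = 1 + 1 / r by linarith] at this
    linarith
  have hz0 : 0 ≤ |z| ^ (r + 1) := by positivity
  have hw0 : 0 ≤ |w| ^ (1 + 1 / r) := by positivity
  have hp0 : 0 < (2 : ℝ) ^ r := by positivity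
  have h1' := mul_le_mul_of_nonneg_left h1 hK0.le
  suffices h2 : z ^ 2 * ((z ^ 2 + ε) ^ r + (w ^ 2 + ε)) ^ a ≤
      (2 ^ r + 1) * |z| ^ (r + 1) + |w| ^ (1 + 1 / r) + δ * z ^ 2 by
    have : 0 ≤ δ * w ^ 2 := by positivity
    nlinarith
  rcases hεδ with rfl | hεδ
  · have : a = 0 := by linarith
    subst this
    rw [Real.rpow_zero]
    have : |z| ^ ((1 : ℝ) + 1) = z ^ 2 := by
      rw [← sq_abs, ← Real.rpow_natCast]; norm_num
    rw [this]
    have h2 : z ^ 2 ≤ (2 ^ (1 : ℝ) + 1) * z ^ 2 :=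
      le_mul_of_one_le_left (sq_nonneg z) (by linarith)
    have h3 := mul_nonneg hδ.le (sq_nonneg z)
    linarith
  · have h3 : ((z ^ 2 + ε) ^ r + (w ^ 2 + ε)) ^ a ≤
        (z ^ 2 + ε) ^ (r * a) + (|w| ^ (2 * a) + ε ^ a) := by
      rw [Real.rpow_mul (hX z).le, ← hsq]
      refine (rpow_add_le_add_rpow (by have := hX z; positivity) (hX w).le ha0
        (by linarith)).trans ?_
      gcongr
      exact rpow_add_le_add_rpow (sq_nonneg w) hε.le ha0 (by linarith)
    have h4 : (z ^ 2 + ε) ^ (r * a) ≤ 2 ^ r * (|z| ^ (r - 1) + ε ^ (r * a)) := by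
      have hra0 : 0 ≤ r * a := by positivity
      have h2r : (2 : ℝ) ^ (r * a) ≤ 2 ^ r :=
        rpow_le_rpow_of_exponent_le (by norm_num) (by linarith)
      rw [← hra, ← hsq]
      rcases le_total (z ^ 2) ε with h | h
      · calc (z ^ 2 + ε) ^ (r * a) ≤ (2 * ε) ^ (r * a) := by gcongr; linarith
          _ = 2 ^ (r * a) * ε ^ (r * a) := Real.mul_rpow (by norm_num) hε.le
          _ ≤ 2 ^ r * ((z ^ 2) ^ (r * a) + ε ^ (r * a)) := by
            gcongr
            linarith [rpow_nonneg (sq_nonneg z) (r * a)]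
      · calc (z ^ 2 + ε) ^ (r * a) ≤ (2 * z ^ 2) ^ (r * a) := by gcongr; linarith
          _ = 2 ^ (r * a) * (z ^ 2) ^ (r * a) := Real.mul_rpow (by norm_num) (sq_nonneg z)
          _ ≤ 2 ^ r * ((z ^ 2) ^ (r * a) + ε ^ (r * a)) := by
            gcongr
            linarith [rpow_nonneg hε.le (r * a)]
    have h5 : z ^ 2 * |z| ^ (r - 1) = |z| ^ (r + 1) := by
      rw [← sq_abs, ← Real.rpow_natCast, ← rpow_add_of_nonneg (abs_nonneg z) (by norm_num)
        (by linarith)]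
      congr 1; push_cast; ring
    have h6 : z ^ 2 * |w| ^ (2 * a) ≤ |z| ^ (r + 1) + |w| ^ (1 + 1 / r) := by
      rcases le_total |z| (|w| ^ (1 / r)) with h | h
      · calc z ^ 2 * |w| ^ (2 * a) ≤ (|w| ^ (1 / r)) ^ 2 * |w| ^ (2 * a) := by
              rw [← sq_abs]; gcongr
          _ = |w| ^ (1 + 1 / r) := by
            rw [← Real.rpow_natCast, ← Real.rpow_mul (abs_nonneg w),
              ← rpow_add_of_nonneg (abs_nonneg w) (by positivity) (by positivity)]
            congr 1; push_cast; linarith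
          _ ≤ _ := by linarith
      · have : |w| ≤ |z| ^ r := by
          have := rpow_le_rpow (by positivity) h hr0.le
          rwa [← Real.rpow_mul (abs_nonneg w), one_div_mul_cancel hr0.ne', Real.rpow_one] at this
        calc z ^ 2 * |w| ^ (2 * a) ≤ z ^ 2 * (|z| ^ r) ^ (2 * a) := by gcongr
          _ = |z| ^ (r + 1) := by
            rw [← Real.rpow_mul (abs_nonneg z), show r * (2 * a) = r - 1 by linarith, h5]
          _ ≤ _ := by linarith
    calc z ^ 2 * ((z ^ 2 + ε) ^ r + (w ^ 2 + ε)) ^ a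
        ≤ z ^ 2 * (2 ^ r * (|z| ^ (r - 1) + ε ^ (r * a)) + (|w| ^ (2 * a) + ε ^ a)) := by
          gcongr
          exact h3.trans (by gcongr)
      _ = 2 ^ r * (z ^ 2 * |z| ^ (r - 1)) + z ^ 2 * |w| ^ (2 * a)
          + (2 ^ r * ε ^ (r * a) + ε ^ a) * z ^ 2 := by ring
      _ ≤ 2 ^ r * |z| ^ (r + 1) + (|z| ^ (r + 1) + |w| ^ (1 + 1 / r)) + δ * z ^ 2 := by
          rw [h5]; gcongr
      _ = _ := by ring

set_option maxHeartbeats 1000000 in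
/-- For `r ≥ 1` there are Bellman functions for the exponents `r + 1` and `1 + 1 / r`. -/
lemma exists_bellmanFunction_aux {r : ℝ} (hr : 1 ≤ r) :
    ∃ C > 0, ∀ δ > 0, Nonempty (BellmanFunction (r + 1) (1 + 1 / r) C δ) := by
  have hr0 : 0 < r := by linarith
  have hr1 : 1 / r ≤ 1 := by rw [div_le_one hr0]; exact hr
  have hr2 : 0 < 1 / r := by positivity
  obtain ⟨a, ha⟩ : ∃ a, 1 - 2 * a = 1 / r := ⟨(1 - 1 / r) / 2, by ring⟩
  obtain ⟨K, hK⟩ : ∃ K, K = (2 + 4 * (1 + r) ^ 2) * r := ⟨_, rfl⟩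
  have hK0 : 0 < K := by rw [hK]; positivity
  have ha0 : 0 ≤ a := by linarith
  have ha1 : a < 1 / 2 := by linarith
  have hra : 2 * (r * a) = r - 1 := by
    have : r * (1 - 2 * a) = 1 := by rw [ha]; field_simp
    linarith
  refine ⟨K + 2 ^ r + 2, by positivity, fun δ hδ => ?_⟩
  obtain ⟨ε, hε, hεδ⟩ : ∃ ε : ℝ, 0 < ε ∧ (r = 1 ∨ 2 ^ r * ε ^ (r * a) + ε ^ a ≤ δ) := by
    rcases eq_or_lt_of_le hr with h | h
    · exact ⟨1, one_pos, Or.inl h.symm⟩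
    · have hra0 : 0 < r * a := by linarith
      have ha0' : 0 < a := pos_of_mul_pos_right hra0 hr0.le
      have : Filter.Tendsto (fun ε : ℝ => 2 ^ r * ε ^ (r * a) + ε ^ a) (nhdsWithin 0 (Set.Ioi 0))
          (nhds 0) := by
        have h : Continuous (fun ε : ℝ => 2 ^ r * ε ^ (r * a) + ε ^ a) :=
          ((continuous_rpow_const hra0.le).const_mul _).add (continuous_rpow_const ha0)
        have := h.tendsto 0
        simp only [zero_rpow hra0.ne', zero_rpow ha0'.ne', mul_zero, add_zero] at this
        exact this.mono_left nhdsWithin_le_nhds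
      obtain ⟨ε, h1, h2⟩ := ((this.eventually (ge_mem_nhds hδ)).and self_mem_nhdsWithin).exists
      exact ⟨ε, h2, Or.inr h1⟩
  have hX : ∀ z : ℝ, 0 < z ^ 2 + ε := fun z => by positivity
  have hS : ∀ z w : ℝ, 0 < (z ^ 2 + ε) ^ r + (w ^ 2 + ε) := fun z w => by positivity
  have dX : ∀ {f : ℝ → ℝ} {f' t : ℝ}, HasDerivAt f f' t →
      HasDerivAt (fun t => f t ^ 2 + ε) (2 * f t * f') t := fun {f f' t} hf => by
    simpa using (hf.pow 2).add_const ε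
  have dXr : ∀ {f : ℝ → ℝ} {f' t : ℝ} (c : ℝ), HasDerivAt f f' t →
      HasDerivAt (fun t => (f t ^ 2 + ε) ^ c) (2 * f t * f' * c * (f t ^ 2 + ε) ^ (c - 1)) t :=
    fun c hf => (dX hf).rpow_const (Or.inl (hX _).ne')
  have dS : ∀ {f g : ℝ → ℝ} {f' g' t : ℝ} (c : ℝ), HasDerivAt f f' t → HasDerivAt g g' t →
      HasDerivAt (fun t => ((f t ^ 2 + ε) ^ r + (g t ^ 2 + ε)) ^ c)
        ((2 * f t * f' * r * (f t ^ 2 + ε) ^ (r - 1) + 2 * g t * g') * c *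
          ((f t ^ 2 + ε) ^ r + (g t ^ 2 + ε)) ^ (c - 1)) t :=
    fun c hf hg => ((dXr r hf).add (dX hg)).rpow_const (Or.inl (hS _ _).ne')
  have cX : ∀ c : ℝ, Continuous fun z : ℝ × ℝ => (z.1 ^ 2 + ε) ^ c := fun c =>
    (by fun_prop : Continuous fun z : ℝ × ℝ => z.1 ^ 2 + ε).rpow_const
      fun z => Or.inl (hX _).ne'
  have cY : ∀ c : ℝ, Continuous fun z : ℝ × ℝ => (z.2 ^ 2 + ε) ^ c := fun c =>
    (by fun_prop : Continuous fun z : ℝ × ℝ => z.2 ^ 2 + ε).rpow_const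
      fun z => Or.inl (hX _).ne'
  have cS : ∀ c : ℝ, Continuous fun z : ℝ × ℝ => ((z.1 ^ 2 + ε) ^ r + (z.2 ^ 2 + ε)) ^ c :=
    fun c => ((cX r).add (by fun_prop)).rpow_const fun z => Or.inl (hS _ _).ne'
  exact ⟨{
    toFun := fun z w => K * ((w ^ 2 + ε) ^ (1 - a) - ε ^ (1 - a))
      + z ^ 2 * ((z ^ 2 + ε) ^ r + (w ^ 2 + ε)) ^ a
    fst := fun z w => 2 * z * ((z ^ 2 + ε) ^ r + (w ^ 2 + ε)) ^ a
      + 2 * a * r * z ^ 3 * ((z ^ 2 + ε) ^ r + (w ^ 2 + ε)) ^ (a - 1) * (z ^ 2 + ε) ^ (r - 1)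
    snd := fun z w => 2 * K * (1 - a) * w * (w ^ 2 + ε) ^ (1 - a - 1)
      + 2 * a * z ^ 2 * w * ((z ^ 2 + ε) ^ r + (w ^ 2 + ε)) ^ (a - 1)
    fstFst := fun z w => 2 * ((z ^ 2 + ε) ^ r + (w ^ 2 + ε)) ^ a
      + 10 * a * r * z ^ 2 * ((z ^ 2 + ε) ^ r + (w ^ 2 + ε)) ^ (a - 1) * (z ^ 2 + ε) ^ (r - 1)
      + 4 * a * r ^ 2 * (a - 1) * z ^ 4 * ((z ^ 2 + ε) ^ r + (w ^ 2 + ε)) ^ (a - 1 - 1)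
        * ((z ^ 2 + ε) ^ (r - 1)) ^ 2
      + 4 * a * r * (r - 1) * z ^ 4 * ((z ^ 2 + ε) ^ r + (w ^ 2 + ε)) ^ (a - 1)
        * (z ^ 2 + ε) ^ (r - 1 - 1)
    fstSnd := fun z w => 4 * a * z * w * ((z ^ 2 + ε) ^ r + (w ^ 2 + ε)) ^ (a - 1)
      + 4 * a * r * (a - 1) * z ^ 3 * w * ((z ^ 2 + ε) ^ r + (w ^ 2 + ε)) ^ (a - 1 - 1)
        * (z ^ 2 + ε) ^ (r - 1)
    sndSnd := fun z w => 2 * K * (1 - a) * ((w ^ 2 + ε) ^ (1 - a - 1)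
        - 2 * a * w ^ 2 * (w ^ 2 + ε) ^ (1 - a - 1 - 1))
      + 2 * a * z ^ 2 * ((z ^ 2 + ε) ^ r + (w ^ 2 + ε)) ^ (a - 1)
      + 4 * a * (a - 1) * z ^ 2 * w ^ 2 * ((z ^ 2 + ε) ^ r + (w ^ 2 + ε)) ^ (a - 1 - 1)
    continuous_toFun := by have := cS a; have := cY (1 - a); fun_prop
    continuous_fst := by
      have := cS a; have := cS (a - 1); have := cX (r - 1); fun_prop
    continuous_snd := by
      have := cS (a - 1); have := cY (1 - a - 1); fun_prop
    continuous_fstFst := by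
      have := cS a; have := cS (a - 1); have := cS (a - 1 - 1); have := cX (r - 1)
      have := cX (r - 1 - 1); fun_prop
    continuous_fstSnd := by
      have := cS (a - 1); have := cS (a - 1 - 1); have := cX (r - 1); fun_prop
    continuous_sndSnd := by
      have := cS (a - 1); have := cS (a - 1 - 1); have := cY (1 - a - 1)
      have := cY (1 - a - 1 - 1); fun_prop
    hasDerivAt_toFun := fun {f g f' g' t} hf hg => by
      convert! (((dXr (1 - a) hg).sub_const (ε ^ (1 - a))).const_mul K).add
        ((hf.pow 2).mul (dS a hf hg)) using 1
      simp only [Pi.pow_apply]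
      ring
    hasDerivAt_fst := fun {f g f' g' t} hf hg => by
      convert! ((hf.const_mul 2).mul (dS a hf hg)).add
        ((((hf.pow 3).const_mul (2 * a * r)).mul (dS (a - 1) hf hg)).mul (dXr (r - 1) hf)) using 1
      simp only [Pi.pow_apply, Pi.mul_apply]
      ring
    hasDerivAt_snd := fun {f g f' g' t} hf hg => by
      convert! ((hg.const_mul (2 * K * (1 - a))).mul (dXr (1 - a - 1) hg)).add
        ((((hf.pow 2).const_mul (2 * a)).mul hg).mul (dS (a - 1) hf hg)) using 1
      simp only [Pi.pow_apply, Pi.mul_apply]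
      ring
    nonneg := fun z w => by
      have h1 : ε ^ (1 - a) ≤ (w ^ 2 + ε) ^ (1 - a) := by
        apply rpow_le_rpow hε.le (by nlinarith) (by linarith)
      have h2 := mul_nonneg hK0.le (sub_nonneg.2 h1)
      have := hS z w
      positivity
    le := bellman_growth hr ha hK0 hε hδ hεδ
    hessian := fun z w => by
      set X := z ^ 2 + ε with hXd
      set Y := w ^ 2 + ε with hYd
      have hX0 : 0 < X := hX z
      have hY0 : 0 < Y := hX w
      have hm0 : 0 < X ^ r := by positivity
      set m := X ^ r with hm
      have hs0 : 0 < m + Y := by positivity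
      set s := m + Y with hs
      have hms : m ≤ s := by linarith
      have hYs : Y ≤ s := by linarith
      rw [rpow_sub_one hX0.ne' (r - 1), rpow_sub_one hX0.ne' r, rpow_sub_one hs0.ne' (a - 1),
        rpow_sub_one hs0.ne' a, rpow_sub_one hY0.ne' (1 - a - 1), sub_sub_cancel_left, ← hm]
      refine ⟨s ^ a, by positivity, bellman_hessian_algebra hr ha hK hX0 hY0 hs0 (by positivity)
        ?_ hm0 (by linarith) (by linarith) hms hYs ?_⟩
      · rw [← Real.rpow_neg hs0.le]
        exact rpow_le_rpow_of_nonpos hY0 hYs (by linarith)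
      · have : X ≤ s ^ (1 - 2 * a) := by
          rw [ha]
          calc X = m ^ (1 / r) := by
                rw [hm, ← Real.rpow_mul hX0.le, mul_one_div_cancel hr0.ne', Real.rpow_one]
            _ ≤ s ^ (1 / r) := by gcongr
        calc X * (s ^ a) ^ 2 ≤ s ^ (1 - 2 * a) * (s ^ a) ^ 2 := by gcongr
          _ = s := by
            rw [← Real.rpow_natCast, ← Real.rpow_mul hs0.le, ← Real.rpow_add hs0]
            conv_rhs => rw [← Real.rpow_one s]
            congr 1; push_cast; ring }⟩

/-- For conjugate exponents there are Bellman functions with arbitrarily small error. -/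
lemma exists_bellmanFunction {p q : ℝ} (hpq : p.HolderConjugate q) :
    ∃ C > 0, ∀ δ > 0, Nonempty (BellmanFunction p q C δ) := by
  have hp := hpq.lt
  have hq := hpq.symm.lt
  have hp1 : 0 < p - 1 := by linarith
  have hq1 : 0 < q - 1 := by linarith
  have hmul : (p - 1) * (q - 1) = 1 := by linarith [hpq.mul_eq_add]
  have e1 : 1 / (p - 1) = q - 1 := by rw [div_eq_iff hp1.ne']; linarith
  have e2 : 1 / (q - 1) = p - 1 := by rw [div_eq_iff hq1.ne']; linarith
  rcases le_total 2 p with h | h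
  · have := exists_bellmanFunction_aux (r := p - 1) (by linarith)
    rwa [sub_add_cancel, e1, add_sub_cancel] at this
  · have h2 : 1 ≤ q - 1 := by nlinarith
    obtain ⟨C, hC, H⟩ := exists_bellmanFunction_aux (r := q - 1) h2
    rw [sub_add_cancel, e2, add_sub_cancel] at H
    exact ⟨C, hC, fun δ hδ => (H δ hδ).map BellmanFunction.swap⟩

section GaussianAverage

open Filter Topology SchwartzMap LineDeriv Laplacian

variable {E : Type*} [NormedAddCommGroup E] [InnerProductSpace ℝ E] [FiniteDimensional ℝ E]
  [MeasurableSpace E] [BorelSpace E]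

lemma integrable_pow_mul_gaussian (k : ℕ) :
    Integrable (fun z : E => (1 + ‖z‖) ^ k * rexp (-π * ‖z‖ ^ 2)) := by
  set d := Module.finrank ℝ E
  have hd : (d : ℝ) < ((d + 1 : ℕ) : ℝ) := by push_cast; linarith
  refine ((integrable_one_add_norm (μ := (volume : Measure E)) hd).const_mul
    (((k + (d + 1)).factorial : ℝ) * rexp 2)).mono' (by fun_prop) (ae_of_all _ fun z => ?_)
  rw [Real.norm_of_nonneg (by positivity), Real.rpow_neg (by positivity), Real.rpow_natCast]
  have h0 : 0 < 1 + ‖z‖ := by positivity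
  have h1 : (1 + ‖z‖) ^ (k + (d + 1)) ≤ (k + (d + 1)).factorial * rexp (1 + ‖z‖) := by
    have := Real.pow_div_factorial_le_exp (1 + ‖z‖) h0.le (k + (d + 1))
    rwa [div_le_iff₀' (by positivity)] at this
  have h2 : rexp (1 + ‖z‖) ≤ rexp 2 * rexp (π * ‖z‖ ^ 2) := by
    rw [← Real.exp_add]
    apply Real.exp_le_exp.2
    nlinarith [Real.pi_gt_three, sq_nonneg (‖z‖ - 1), sq_nonneg ‖z‖]
  rw [← div_eq_mul_inv, le_div_iff₀ (by positivity)]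
  calc (1 + ‖z‖) ^ k * rexp (-π * ‖z‖ ^ 2) * (1 + ‖z‖) ^ (d + 1)
      = (1 + ‖z‖) ^ (k + (d + 1)) * rexp (-π * ‖z‖ ^ 2) := by ring
    _ ≤ ((k + (d + 1)).factorial * (rexp 2 * rexp (π * ‖z‖ ^ 2))) * rexp (-π * ‖z‖ ^ 2) := by
        gcongr
        exact h1.trans (by gcongr)
    _ = (k + (d + 1)).factorial * rexp 2 * (rexp (π * ‖z‖ ^ 2) * rexp (-π * ‖z‖ ^ 2)) := by ring
    _ = _ := by rw [← Real.exp_add]; simp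

lemma integrable_gaussian : Integrable (fun z : E => rexp (-π * ‖z‖ ^ 2)) := by
  simpa using integrable_pow_mul_gaussian (E := E) 0

lemma integral_gaussian_eq_one : ∫ z : E, rexp (-π * ‖z‖ ^ 2) = 1 := by
  rw [GaussianFourier.integral_rexp_neg_mul_sq_norm Real.pi_pos, div_self Real.pi_ne_zero,
    Real.one_rpow]

/-- The average of `f` around `x` against a Gaussian of width `s`; this is the solution of the heat
equation at time `s² / (4π)`. -/
noncomputable def gaussianAverage (f : E → ℝ) (s : ℝ) (x : E) : ℝ :=
  ∫ z, rexp (-π * ‖z‖ ^ 2) * f (x + s • z)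

lemma gaussianAverage_zero (f : E → ℝ) (x : E) : gaussianAverage f 0 x = f x := by
  simp only [gaussianAverage, zero_smul, add_zero]
  rw [integral_mul_const, integral_gaussian_eq_one, one_mul]

omit [FiniteDimensional ℝ E] [MeasurableSpace E] [BorelSpace E] in
lemma SchwartzMap.exists_pow_mul_abs_le (f : 𝓢(E, ℝ)) (k : ℕ) :
    ∃ C > 0, ∀ x, (1 + ‖x‖) ^ k * |f x| ≤ C := by
  refine ⟨2 ^ k * (Finset.Iic (k, 0)).sup (fun m => SchwartzMap.seminorm ℝ m.1 m.2) f + 1,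
    by positivity, fun x => ?_⟩
  have := one_add_le_sup_seminorm_apply (𝕜 := ℝ) (m := (k, 0)) le_rfl le_rfl f x
  rw [norm_iteratedFDeriv_zero, Real.norm_eq_abs] at this
  linarith

omit [FiniteDimensional ℝ E] [MeasurableSpace E] [BorelSpace E] in
lemma SchwartzMap.exists_abs_le (f : 𝓢(E, ℝ)) : ∃ C > 0, ∀ x, |f x| ≤ C := by
  simpa using f.exists_pow_mul_abs_le 0

lemma integrable_gaussian_mul (f : 𝓢(E, ℝ)) (s : ℝ) (x : E) :
    Integrable fun z => rexp (-π * ‖z‖ ^ 2) * f (x + s • z) := by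
  obtain ⟨C, -, hC⟩ := f.exists_abs_le
  have := f.continuous
  exact integrable_gaussian.mul_bdd (c := C) (by fun_prop) (ae_of_all _ fun z => hC _)

lemma abs_gaussianAverage_le {f : 𝓢(E, ℝ)} {C : ℝ} (hC : ∀ x, |f x| ≤ C) (s : ℝ) (x : E) :
    |gaussianAverage f s x| ≤ C := by
  have h := norm_integral_le_of_norm_le (μ := volume)
    (f := fun z => rexp (-π * ‖z‖ ^ 2) * f (x + s • z)) (integrable_gaussian.mul_const C)
    (ae_of_all _ fun z => by
      rw [norm_mul, Real.norm_of_nonneg (by positivity)]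
      gcongr
      exact hC _)
  rwa [integral_mul_const, integral_gaussian_eq_one, one_mul] at h

lemma continuous_gaussianAverage (f : 𝓢(E, ℝ)) (s : ℝ) :
    Continuous (gaussianAverage f s) := by
  obtain ⟨C, -, hC⟩ := f.exists_abs_le
  have := f.continuous
  refine continuous_of_dominated (fun x => by fun_prop) (fun x => ae_of_all _ fun z => ?_)
    (integrable_gaussian.mul_const C) (ae_of_all _ fun z => by fun_prop)
  rw [norm_mul, Real.norm_of_nonneg (by positivity)]
  gcongr
  exact hC _

lemma exists_pow_mul_abs_gaussianAverage_le (f : 𝓢(E, ℝ)) (k : ℕ) (R : ℝ) :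
    ∃ C > 0, ∀ s, |s| ≤ R → ∀ x, (1 + ‖x‖) ^ k * |gaussianAverage f s x| ≤ C := by
  obtain ⟨C, hC0, hC⟩ := f.exists_pow_mul_abs_le k
  have hI : 0 ≤ ∫ z : E, (1 + ‖z‖) ^ k * rexp (-π * ‖z‖ ^ 2) :=
    integral_nonneg fun z => by positivity
  refine ⟨(∫ z : E, (1 + ‖z‖) ^ k * rexp (-π * ‖z‖ ^ 2)) * ((1 + |R|) ^ k * C) + 1, by positivity,
    fun s hs x => ?_⟩
  have hx : 0 ≤ (1 + ‖x‖) ^ k := by positivity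
  have hsR : |s| ≤ |R| := hs.trans (le_abs_self R)
  have h := norm_integral_le_of_norm_le (μ := volume)
    (f := fun z => (1 + ‖x‖) ^ k * (rexp (-π * ‖z‖ ^ 2) * f (x + s • z)))
    ((integrable_pow_mul_gaussian k).mul_const ((1 + |R|) ^ k * C))
    (ae_of_all _ fun z => by
      have h1 : 1 + ‖x‖ ≤ (1 + |R|) * (1 + ‖z‖) * (1 + ‖x + s • z‖) := by
        have h2 : ‖x‖ ≤ ‖x + s • z‖ + |s| * ‖z‖ := by
          rw [← Real.norm_eq_abs, ← norm_smul]
          simpa using norm_sub_le (x + s • z) (s • z)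
        have h3 : |s| * ‖z‖ ≤ |R| * ‖z‖ := by gcongr
        have h4 : 0 ≤ |R| * ‖z‖ := by positivity
        have h5 : 0 ≤ (|R| + ‖z‖ + |R| * ‖z‖) * ‖x + s • z‖ := by positivity
        nlinarith [abs_nonneg R, norm_nonneg z]
      rw [norm_mul, norm_mul, Real.norm_of_nonneg hx, Real.norm_of_nonneg (by positivity),
        Real.norm_eq_abs]
      calc (1 + ‖x‖) ^ k * (rexp (-π * ‖z‖ ^ 2) * |f (x + s • z)|)
          ≤ ((1 + |R|) * (1 + ‖z‖) * (1 + ‖x + s • z‖)) ^ k *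
            (rexp (-π * ‖z‖ ^ 2) * |f (x + s • z)|) := by gcongr
        _ = (1 + ‖z‖) ^ k * rexp (-π * ‖z‖ ^ 2) *
            ((1 + |R|) ^ k * ((1 + ‖x + s • z‖) ^ k * |f (x + s • z)|)) := by
              rw [mul_pow, mul_pow]; ring
        _ ≤ _ := by gcongr; exact hC _)
  rw [integral_const_mul, norm_mul, Real.norm_of_nonneg hx, integral_mul_const] at h
  calc _ ≤ _ := h
    _ ≤ _ := by linarith

/-- Gaussian averages of widths in a bounded set are dominated by an integrable function. -/
lemma exists_integrable_bound_gaussianAverage (f : 𝓢(E, ℝ)) (R : ℝ) :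
    ∃ b : E → ℝ, Integrable b ∧ ∀ s, |s| ≤ R → ∀ x, |gaussianAverage f s x| ≤ b x := by
  set d := Module.finrank ℝ E
  have hd : (d : ℝ) < ((d + 1 : ℕ) : ℝ) := by push_cast; linarith
  obtain ⟨C, -, hC⟩ := exists_pow_mul_abs_gaussianAverage_le f (d + 1) R
  refine ⟨_, (integrable_one_add_norm (μ := (volume : Measure E)) hd).const_mul C,
    fun s hs x => ?_⟩
  rw [Real.rpow_neg (by positivity), Real.rpow_natCast, ← div_eq_mul_inv,
    le_div_iff₀ (by positivity), mul_comm]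
  exact hC s hs x

lemma integrable_gaussianAverage (f : 𝓢(E, ℝ)) (s : ℝ) : Integrable (gaussianAverage f s) := by
  obtain ⟨b, hb, h⟩ := exists_integrable_bound_gaussianAverage f |s|
  exact hb.mono' (continuous_gaussianAverage f s).aestronglyMeasurable
    (ae_of_all _ fun x => h s le_rfl x)

lemma hasLineDerivAt_gaussianAverage (f : 𝓢(E, ℝ)) (s : ℝ) (v x : E) :
    HasLineDerivAt ℝ (gaussianAverage f s) (gaussianAverage (∂_{v} f : 𝓢(E, ℝ)) s x) x v := by
  obtain ⟨C, -, hC⟩ := (∂_{v} f : 𝓢(E, ℝ)).exists_abs_le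
  have := f.continuous
  have := (∂_{v} f : 𝓢(E, ℝ)).continuous
  have key := (hasDerivAt_integral_of_dominated_loc_of_deriv_le (μ := volume) (x₀ := (0 : ℝ))
    (s := Set.univ) (F := fun t z => rexp (-π * ‖z‖ ^ 2) * f (x + t • v + s • z))
    (F' := fun t z => rexp (-π * ‖z‖ ^ 2) * (∂_{v} f : 𝓢(E, ℝ)) (x + t • v + s • z))
    (bound := fun z => rexp (-π * ‖z‖ ^ 2) * C) univ_mem
    (Eventually.of_forall fun t => by fun_prop) (integrable_gaussian_mul f s _)
    (by fun_prop) (ae_of_all _ fun z t _ => ?_) (integrable_gaussian.mul_const C)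
    (ae_of_all _ fun z t _ => ?_)).2
  · simpa [HasLineDerivAt, gaussianAverage] using key
  · rw [norm_mul, Real.norm_of_nonneg (by positivity)]
    gcongr
    exact hC _
  · refine HasDerivAt.const_mul _ ?_
    have h1 : HasDerivAt (fun t : ℝ => x + t • v + s • z) v t := by
      simpa using (((hasDerivAt_id t).smul_const v).const_add x).add_const (s • z)
    exact (f.hasFDerivAt (x + t • v + s • z)).comp_hasDerivAt t h1

omit [FiniteDimensional ℝ E] [MeasurableSpace E] [BorelSpace E] in
lemma hasLineDerivAt_gaussian (v z : E) :
    HasLineDerivAt ℝ (fun z : E => rexp (-π * ‖z‖ ^ 2))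
      (-(2 * π) * (inner ℝ z v * rexp (-π * ‖z‖ ^ 2))) z v := by
  have h := (((hasStrictFDerivAt_norm_sq z).hasFDerivAt.const_mul (-π)).exp).hasLineDerivAt v
  convert! h using 1
  simp
  ring

lemma integrable_inner_gaussian_mul (f : 𝓢(E, ℝ)) (s : ℝ) (x v : E) :
    Integrable fun z => inner ℝ z v * rexp (-π * ‖z‖ ^ 2) * f (x + s • z) := by
  obtain ⟨C, hC0, hC⟩ := f.exists_abs_le
  have := f.continuous
  refine ((integrable_pow_mul_gaussian 1).mul_const (‖v‖ * C)).mono' (by fun_prop)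
    (ae_of_all _ fun z => ?_)
  rw [norm_mul, norm_mul, Real.norm_of_nonneg (Real.exp_nonneg _)]
  calc ‖(inner ℝ z v : ℝ)‖ * rexp (-π * ‖z‖ ^ 2) * ‖f (x + s • z)‖
      ≤ ((1 + ‖z‖) * ‖v‖) * rexp (-π * ‖z‖ ^ 2) * C := by
        gcongr
        · exact (norm_inner_le_norm z v).trans (by gcongr; linarith)
        · exact hC _
    _ = _ := by ring

/-- Gaussian integration by parts. -/
lemma integral_inner_gaussian_mul (f : 𝓢(E, ℝ)) (s : ℝ) (x v : E) :
    ∫ z, inner ℝ z v * rexp (-π * ‖z‖ ^ 2) * f (x + s • z) =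
      s / (2 * π) * gaussianAverage (∂_{v} f : 𝓢(E, ℝ)) s x := by
  have h := integral_bilinear_hasLineDerivAt_right_eq_neg_left_of_integrable (μ := volume)
    (f := fun z : E => f (x + s • z)) (f' := fun z => s * (∂_{v} f : 𝓢(E, ℝ)) (x + s • z))
    (g := fun z : E => rexp (-π * ‖z‖ ^ 2))
    (g' := fun z => -(2 * π) * (inner ℝ z v * rexp (-π * ‖z‖ ^ 2))) (v := v)
    (B := ContinuousLinearMap.mul ℝ ℝ) ?_ ?_ ?_ ?_ (fun z _ => hasLineDerivAt_gaussian v z)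
  · simp only [ContinuousLinearMap.mul_apply'] at h
    have e1 : ∫ z, f (x + s • z) * (-(2 * π) * (inner ℝ z v * rexp (-π * ‖z‖ ^ 2))) =
        -(2 * π) * ∫ z, inner ℝ z v * rexp (-π * ‖z‖ ^ 2) * f (x + s • z) := by
      rw [← integral_const_mul]; congr 1; ext z; ring
    have e2 : ∫ z, s * (∂_{v} f : 𝓢(E, ℝ)) (x + s • z) * rexp (-π * ‖z‖ ^ 2) =
        s * gaussianAverage (∂_{v} f : 𝓢(E, ℝ)) s x := by
      rw [gaussianAverage, ← integral_const_mul]; congr 1; ext z; ring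
    rw [e1, e2] at h
    rw [div_mul_eq_mul_div, _root_.eq_div_iff (by positivity)]
    linarith
  · simpa [mul_comm, mul_left_comm, mul_assoc] using
      (integrable_gaussian_mul (∂_{v} f : 𝓢(E, ℝ)) s x).const_mul s
  · convert! (integrable_inner_gaussian_mul f s x v).const_mul (-(2 * π)) using 2
    simp; ring
  · simpa [mul_comm] using integrable_gaussian_mul f s x
  · intro z _
    have h1 : HasDerivAt (fun t : ℝ => x + s • (z + t • v)) (s • v) 0 := by
      simpa using ((((hasDerivAt_id (0 : ℝ)).smul_const v).const_add z).const_smul s).const_add x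
    have := (f.hasFDerivAt (x + s • (z + (0 : ℝ) • v))).comp_hasDerivAt 0 h1
    simpa [HasLineDerivAt, SchwartzMap.lineDerivOp_apply_eq_fderiv, Function.comp_def] using this

/-- The heat equation for Gaussian averages, in terms of the width. -/
lemma hasDerivAt_gaussianAverage (f : 𝓢(E, ℝ)) (s : ℝ) (x : E) :
    HasDerivAt (fun s => gaussianAverage f s x)
      (s / (2 * π) * gaussianAverage (Δ f : 𝓢(E, ℝ)) s x) s := by
  set v := stdOrthonormalBasis ℝ E
  have hD : ∀ y z : E, fderiv ℝ f y z = ∑ i, inner ℝ z (v i) * (∂_{v i} f : 𝓢(E, ℝ)) y := by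
    intro y z
    conv_lhs => rw [← v.sum_repr' z]
    simp [SchwartzMap.lineDerivOp_apply_eq_fderiv, real_inner_comm]
  choose C hC0 hC using fun i => (∂_{v i} f : 𝓢(E, ℝ)).exists_abs_le
  have := f.continuous
  have hcont : ∀ i, Continuous (∂_{v i} f : 𝓢(E, ℝ)) := fun i => SchwartzMap.continuous _
  have key := (hasDerivAt_integral_of_dominated_loc_of_deriv_le (μ := volume) (x₀ := s)
    (s := Set.univ) (F := fun s z => rexp (-π * ‖z‖ ^ 2) * f (x + s • z))
    (F' := fun s z => ∑ i, inner ℝ z (v i) * rexp (-π * ‖z‖ ^ 2) *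
      (∂_{v i} f : 𝓢(E, ℝ)) (x + s • z))
    (bound := fun z => (1 + ‖z‖) ^ 1 * rexp (-π * ‖z‖ ^ 2) * ∑ i, C i) univ_mem
    (Eventually.of_forall fun t => by fun_prop) (integrable_gaussian_mul f s _)
    (by fun_prop) (ae_of_all _ fun z t _ => ?_) ((integrable_pow_mul_gaussian 1).mul_const _)
    (ae_of_all _ fun z t _ => ?_)).2
  · convert! key using 1
    rw [integral_finsetSum _ fun i _ => integrable_inner_gaussian_mul _ s x (v i)]
    simp_rw [integral_inner_gaussian_mul]
    rw [← Finset.mul_sum]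
    congr 1
    simp_rw [gaussianAverage]
    rw [← integral_finsetSum _ fun i _ => integrable_gaussian_mul _ s x]
    congr 1
    ext z
    rw [← Finset.mul_sum, SchwartzMap.laplacian_eq_sum v, _root_.sum_apply]
  · refine (norm_sum_le _ _).trans ?_
    rw [Finset.mul_sum]
    gcongr with i
    rw [norm_mul, norm_mul, Real.norm_of_nonneg (Real.exp_nonneg _)]
    gcongr
    · exact (norm_inner_le_norm z (v i)).trans (by simp)
    · exact hC i _
  · have h1 : HasDerivAt (fun t : ℝ => x + t • z) z t := by
      simpa using ((hasDerivAt_id t).smul_const z).const_add x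
    convert! ((f.hasFDerivAt (x + t • z)).comp_hasDerivAt t h1).const_mul
      (rexp (-π * ‖z‖ ^ 2)) using 1
    rw [hD, Finset.mul_sum]
    exact Finset.sum_congr rfl fun i _ => by ring

/-- Gaussian averages of first derivatives decay as the width grows. -/
lemma exists_abs_gaussianAverage_lineDeriv_le (f : 𝓢(E, ℝ)) (v : E) :
    ∃ C, ∀ s > 0, ∀ x, |gaussianAverage (∂_{v} f : 𝓢(E, ℝ)) s x| ≤ C / s := by
  obtain ⟨C, hC0, hC⟩ := f.exists_abs_le
  refine ⟨2 * π * ((∫ z : E, (1 + ‖z‖) ^ 1 * rexp (-π * ‖z‖ ^ 2)) * (‖v‖ * C)), fun s hs x => ?_⟩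
  have h := norm_integral_le_of_norm_le (μ := volume)
    (f := fun z => inner ℝ z v * rexp (-π * ‖z‖ ^ 2) * f (x + s • z))
    ((integrable_pow_mul_gaussian 1).mul_const (‖v‖ * C))
    (ae_of_all _ fun z => by
      rw [norm_mul, norm_mul, Real.norm_of_nonneg (Real.exp_nonneg _)]
      calc ‖(inner ℝ z v : ℝ)‖ * rexp (-π * ‖z‖ ^ 2) * ‖f (x + s • z)‖
          ≤ ((1 + ‖z‖) * ‖v‖) * rexp (-π * ‖z‖ ^ 2) * C := by
            gcongr
            · exact (norm_inner_le_norm z v).trans (by gcongr; linarith)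
            · exact hC _
        _ = _ := by ring)
  rw [integral_inner_gaussian_mul, integral_mul_const, norm_mul,
    Real.norm_of_nonneg (by positivity), Real.norm_eq_abs] at h
  rw [le_div_iff₀ hs]
  have hpi := Real.pi_pos
  rw [div_mul_eq_mul_div, div_le_iff₀ (by positivity)] at h
  linarith

lemma integral_abs_gaussianAverage_le (f : 𝓢(E, ℝ)) (s : ℝ) :
    ∫ x, |gaussianAverage f s x| ≤ ∫ x, |f x| := by
  have hf := f.continuous
  have hm : Measurable fun y : E => ‖f y‖ₑ := hf.enorm.measurable
  have h : ∫⁻ x, ‖gaussianAverage f s x‖ₑ ≤ ∫⁻ x, ‖f x‖ₑ := by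
    calc ∫⁻ x, ‖gaussianAverage f s x‖ₑ
        ≤ ∫⁻ x, ∫⁻ z, ‖rexp (-π * ‖z‖ ^ 2)‖ₑ * ‖f (x + s • z)‖ₑ := by
          gcongr with x
          refine (enorm_integral_le_lintegral_enorm _).trans_eq ?_
          simp_rw [enorm_mul]
      _ = ∫⁻ z : E, ∫⁻ x, ‖rexp (-π * ‖z‖ ^ 2)‖ₑ * ‖f (x + s • z)‖ₑ := by
          refine lintegral_lintegral_swap (Measurable.aemeasurable ?_)
          exact Measurable.mul (by fun_prop) (hm.comp (by fun_prop))
      _ = ∫⁻ z : E, ‖rexp (-π * ‖z‖ ^ 2)‖ₑ * ∫⁻ x, ‖f x‖ₑ := by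
          congr 1
          ext z
          have hz : Measurable fun x : E => ‖f (x + s • z)‖ₑ := hm.comp (by fun_prop)
          rw [lintegral_const_mul _ hz,
            lintegral_add_right_eq_self (fun x => ‖f x‖ₑ) (s • z)]
      _ = ∫⁻ x, ‖f x‖ₑ := by
          rw [lintegral_mul_const _ (by fun_prop)]
          have : ∫⁻ z : E, ‖rexp (-π * ‖z‖ ^ 2)‖ₑ = 1 := by
            simp_rw [Real.enorm_of_nonneg (Real.exp_nonneg _)]
            rw [← ofReal_integral_eq_lintegral_ofReal integrable_gaussian
              (ae_of_all _ fun z => Real.exp_nonneg _), integral_gaussian_eq_one, ofReal_one]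
          rw [this, one_mul]
  simp_rw [← Real.norm_eq_abs]
  rw [integral_norm_eq_lintegral_enorm (continuous_gaussianAverage f s).aestronglyMeasurable,
    integral_norm_eq_lintegral_enorm hf.aestronglyMeasurable]
  exact ENNReal.toReal_mono f.integrable.2.ne h

omit [FiniteDimensional ℝ E] [MeasurableSpace E] [BorelSpace E] in
lemma SchwartzMap.lineDerivOp_comm (f : 𝓢(E, ℝ)) (v w : E) :
    (∂_{v} (∂_{w} f) : 𝓢(E, ℝ)) = ∂_{w} (∂_{v} f) := by
  ext x
  have h : ∀ a b : E, (∂_{a} (∂_{b} f) : 𝓢(E, ℝ)) x = fderiv ℝ (fderiv ℝ f) x a b := fun a b => by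
    rw [SchwartzMap.lineDerivOp_apply_eq_fderiv]
    have : ((∂_{b} f : 𝓢(E, ℝ)) : E → ℝ) = fun y => fderiv ℝ f y b := by
      ext y
      exact SchwartzMap.lineDerivOp_apply_eq_fderiv ..
    rw [this, fderiv_clm_apply
      (((f.smooth 2).fderiv_right (m := 1) (by norm_num)).differentiable (by norm_num) x)
      (differentiableAt_const b)]
    simp
  rw [h, h]
  exact ((f.smooth 2).contDiffAt.isSymmSndFDerivAt (by simp)) v w

omit [MeasurableSpace E] [BorelSpace E] in
lemma SchwartzMap.laplacian_lineDerivOp (f : 𝓢(E, ℝ)) (v : E) :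
    (Δ (∂_{v} f) : 𝓢(E, ℝ)) = ∂_{v} (Δ f) := by
  simp_rw [SchwartzMap.laplacian_eq_sum (stdOrthonormalBasis ℝ E), lineDerivOp_sum]
  refine Finset.sum_congr rfl fun i _ => ?_
  rw [(∂_{_} f : 𝓢(E, ℝ)).lineDerivOp_comm v, f.lineDerivOp_comm v]

lemma gaussianAverage_laplacian {ι : Type*} [Fintype ι] (v : OrthonormalBasis ι ℝ E)
    (f : 𝓢(E, ℝ)) (s : ℝ) (x : E) :
    gaussianAverage (Δ f : 𝓢(E, ℝ)) s x =
      ∑ i, gaussianAverage (∂_{v i} (∂_{v i} f) : 𝓢(E, ℝ)) s x := by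
  simp_rw [gaussianAverage]
  rw [← integral_finsetSum _ fun i _ => integrable_gaussian_mul _ s x]
  congr 1
  ext z
  rw [← Finset.mul_sum, SchwartzMap.laplacian_eq_sum v, _root_.sum_apply]

lemma integrable_mul_gaussianAverage {h : E → ℝ} {K : ℝ} (hc : Continuous h)
    (hK : ∀ x, |h x| ≤ K) (f : 𝓢(E, ℝ)) (s : ℝ) :
    Integrable fun x => h x * gaussianAverage f s x :=
  (integrable_gaussianAverage f s).bdd_mul hc.aestronglyMeasurable (ae_of_all _ hK)

lemma integrable_gaussianAverage_mul_gaussianAverage (f g : 𝓢(E, ℝ)) (s : ℝ) :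
    Integrable fun x => gaussianAverage f s x * gaussianAverage g s x := by
  obtain ⟨K, -, hK⟩ := f.exists_abs_le
  exact integrable_mul_gaussianAverage (continuous_gaussianAverage f s)
    (abs_gaussianAverage_le hK s) g s

/-- Integration by parts against a Gaussian average. -/
lemma integral_mul_gaussianAverage_lineDeriv {h h' : E → ℝ} {K K' : ℝ} (hc : Continuous h)
    (hK : ∀ x, |h x| ≤ K) (hc' : Continuous h') (hK' : ∀ x, |h' x| ≤ K') {v : E}
    (hd : ∀ x, HasLineDerivAt ℝ h (h' x) x v) (f : 𝓢(E, ℝ)) (s : ℝ) :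
    ∫ x, h x * gaussianAverage (∂_{v} f : 𝓢(E, ℝ)) s x =
      -∫ x, h' x * gaussianAverage f s x :=
  integral_bilinear_hasLineDerivAt_right_eq_neg_left_of_integrable (μ := volume)
    (B := ContinuousLinearMap.mul ℝ ℝ) (integrable_mul_gaussianAverage hc' hK' f s)
    (integrable_mul_gaussianAverage hc hK _ s) (integrable_mul_gaussianAverage hc hK f s)
    (fun x _ => hd x) (fun x _ => hasLineDerivAt_gaussianAverage f s v x)

lemma integral_gaussianAverage_mul_lineDeriv (f g : 𝓢(E, ℝ)) (s : ℝ) (v : E) :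
    ∫ x, gaussianAverage f s x * gaussianAverage (∂_{v} g : 𝓢(E, ℝ)) s x =
      -∫ x, gaussianAverage (∂_{v} f : 𝓢(E, ℝ)) s x * gaussianAverage g s x := by
  obtain ⟨K, -, hK⟩ := f.exists_abs_le
  obtain ⟨K', -, hK'⟩ := (∂_{v} f : 𝓢(E, ℝ)).exists_abs_le
  exact integral_mul_gaussianAverage_lineDeriv (continuous_gaussianAverage _ _)
    (abs_gaussianAverage_le hK s) (continuous_gaussianAverage _ _)
    (abs_gaussianAverage_le hK' s) (hasLineDerivAt_gaussianAverage f s v) g s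

lemma integral_gaussianAverage_mul_laplacian (f g : 𝓢(E, ℝ)) (s : ℝ) :
    ∫ x, gaussianAverage f s x * gaussianAverage (Δ g : 𝓢(E, ℝ)) s x =
      ∫ x, gaussianAverage (Δ f : 𝓢(E, ℝ)) s x * gaussianAverage g s x := by
  simp_rw [gaussianAverage_laplacian (stdOrthonormalBasis ℝ E), Finset.mul_sum, Finset.sum_mul]
  rw [integral_finsetSum _ fun i _ => integrable_gaussianAverage_mul_gaussianAverage _ _ s,
    integral_finsetSum _ fun i _ => integrable_gaussianAverage_mul_gaussianAverage _ _ s]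
  refine Finset.sum_congr rfl fun i _ => ?_
  rw [integral_gaussianAverage_mul_lineDeriv, neg_eq_iff_eq_neg,
    integral_gaussianAverage_mul_lineDeriv]

lemma continuous_comp_gaussianAverage
    {c : ℝ → ℝ → ℝ} (hc : Continuous fun z : ℝ × ℝ => c z.1 z.2) (f g : 𝓢(E, ℝ)) (s : ℝ) :
    Continuous fun x => c (gaussianAverage f s x) (gaussianAverage g s x) :=
  hc.comp ((continuous_gaussianAverage f s).prodMk (continuous_gaussianAverage g s))

lemma exists_abs_comp_gaussianAverage_le {c : ℝ → ℝ → ℝ}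
    (hc : Continuous fun z : ℝ × ℝ => c z.1 z.2) (f g : 𝓢(E, ℝ)) :
    ∃ K, ∀ s x, |c (gaussianAverage f s x) (gaussianAverage g s x)| ≤ K := by
  obtain ⟨A, -, hA⟩ := f.exists_abs_le
  obtain ⟨B, -, hB⟩ := g.exists_abs_le
  obtain ⟨K, hK⟩ := (isCompact_Icc.prod isCompact_Icc :
    IsCompact (Set.Icc (-A) A ×ˢ Set.Icc (-B) B)).exists_bound_of_continuousOn hc.continuousOn
  exact ⟨K, fun s x => hK (gaussianAverage f s x, gaussianAverage g s x)
    ⟨abs_le.1 (abs_gaussianAverage_le hA s x), abs_le.1 (abs_gaussianAverage_le hB s x)⟩⟩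

/-- Differentiation of `∫ c(F, G)` along the heat flow. -/
lemma hasDerivAt_integral_comp_gaussianAverage {c c₁ c₂ : ℝ → ℝ → ℝ}
    (hc : Continuous fun z : ℝ × ℝ => c z.1 z.2) (hc₁ : Continuous fun z : ℝ × ℝ => c₁ z.1 z.2)
    (hc₂ : Continuous fun z : ℝ × ℝ => c₂ z.1 z.2)
    (hd : ∀ {f g : ℝ → ℝ} {f' g' t : ℝ}, HasDerivAt f f' t → HasDerivAt g g' t →
      HasDerivAt (fun t => c (f t) (g t)) (c₁ (f t) (g t) * f' + c₂ (f t) (g t) * g') t)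
    (f g : 𝓢(E, ℝ)) (s : ℝ)
    (hi : Integrable fun x => c (gaussianAverage f s x) (gaussianAverage g s x)) :
    HasDerivAt (fun s => ∫ x, c (gaussianAverage f s x) (gaussianAverage g s x))
      (s / (2 * π) * ((∫ x, c₁ (gaussianAverage f s x) (gaussianAverage g s x) *
          gaussianAverage (Δ f : 𝓢(E, ℝ)) s x) +
        ∫ x, c₂ (gaussianAverage f s x) (gaussianAverage g s x) *
          gaussianAverage (Δ g : 𝓢(E, ℝ)) s x)) s := by
  obtain ⟨K₁, hK₁⟩ := exists_abs_comp_gaussianAverage_le hc₁ f g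
  obtain ⟨K₂, hK₂⟩ := exists_abs_comp_gaussianAverage_le hc₂ f g
  obtain ⟨b₁, hb₁, hbf⟩ := exists_integrable_bound_gaussianAverage (Δ f : 𝓢(E, ℝ)) (|s| + 1)
  obtain ⟨b₂, hb₂, hbg⟩ := exists_integrable_bound_gaussianAverage (Δ g : 𝓢(E, ℝ)) (|s| + 1)
  have hi₁ := integrable_mul_gaussianAverage (continuous_comp_gaussianAverage hc₁ f g s) (hK₁ s)
    (Δ f : 𝓢(E, ℝ)) s
  have hi₂ := integrable_mul_gaussianAverage (continuous_comp_gaussianAverage hc₂ f g s) (hK₂ s)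
    (Δ g : 𝓢(E, ℝ)) s
  have key := (hasDerivAt_integral_of_dominated_loc_of_deriv_le (μ := volume) (x₀ := s)
    (s := Metric.ball s 1)
    (F := fun s x => c (gaussianAverage f s x) (gaussianAverage g s x))
    (F' := fun s x => c₁ (gaussianAverage f s x) (gaussianAverage g s x) *
        (s / (2 * π) * gaussianAverage (Δ f : 𝓢(E, ℝ)) s x) +
      c₂ (gaussianAverage f s x) (gaussianAverage g s x) *
        (s / (2 * π) * gaussianAverage (Δ g : 𝓢(E, ℝ)) s x))
    (bound := fun x => K₁ * ((|s| + 1) / (2 * π) * b₁ x) + K₂ * ((|s| + 1) / (2 * π) * b₂ x))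
    (Metric.ball_mem_nhds s one_pos)
    (Eventually.of_forall fun t => (continuous_comp_gaussianAverage hc f g t).aestronglyMeasurable)
    hi ?_ (ae_of_all _ fun x t ht => ?_)
    (((hb₁.const_mul _).const_mul _).add ((hb₂.const_mul _).const_mul _))
    (ae_of_all _ fun x t _ =>
      hd (hasDerivAt_gaussianAverage f t x) (hasDerivAt_gaussianAverage g t x))).2
  · convert! key using 1
    rw [← integral_add hi₁ hi₂, ← integral_const_mul]
    congr 1
    ext x
    ring
  · refine Continuous.aestronglyMeasurable ?_
    have h₁ := continuous_comp_gaussianAverage hc₁ f g s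
    have h₂ := continuous_comp_gaussianAverage hc₂ f g s
    have h₃ := continuous_gaussianAverage (Δ f : 𝓢(E, ℝ)) s
    have h₄ := continuous_gaussianAverage (Δ g : 𝓢(E, ℝ)) s
    exact (h₁.mul (continuous_const.mul h₃)).add (h₂.mul (continuous_const.mul h₄))
  · have ht' : |t| ≤ |s| + 1 := by
      have := abs_sub_abs_le_abs_sub t s
      rw [Metric.mem_ball, Real.dist_eq] at ht
      linarith
    have hπ : |t / (2 * π)| ≤ (|s| + 1) / (2 * π) := by
      rw [abs_div, abs_of_pos (a := 2 * π) (by positivity)]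
      gcongr
    have hK₁0 : 0 ≤ K₁ := (abs_nonneg _).trans (hK₁ t x)
    have hK₂0 : 0 ≤ K₂ := (abs_nonneg _).trans (hK₂ t x)
    refine (norm_add_le _ _).trans ?_
    simp only [Real.norm_eq_abs, abs_mul]
    gcongr
    · exact hK₁ t x
    · exact hbf t ht' x
    · exact hK₂ t x
    · exact hbg t ht' x

lemma BellmanFunction.integrable_comp_gaussianAverage {p q C δ : ℝ} (hp : 1 < p) (hq : 1 < q)
    (hC : 0 ≤ C) (hδ : 0 ≤ δ) (B : BellmanFunction p q C δ) (f g : 𝓢(E, ℝ)) (s : ℝ) :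
    Integrable fun x => B.toFun (gaussianAverage f s x) (gaussianAverage g s x) := by
  obtain ⟨K, hK0, hK⟩ := f.exists_abs_le
  obtain ⟨L, hL0, hL⟩ := g.exists_abs_le
  refine ((((integrable_gaussianAverage f s).abs.const_mul (K ^ (p - 1))).add
      ((integrable_gaussianAverage g s).abs.const_mul (L ^ (q - 1)))).const_mul C |>.add
    ((((integrable_gaussianAverage f s).abs.const_mul K).add
      ((integrable_gaussianAverage g s).abs.const_mul L)).const_mul δ)).mono'
    (continuous_comp_gaussianAverage B.continuous_toFun f g s).aestronglyMeasurable
    (ae_of_all _ fun x => ?_)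
  rw [Real.norm_of_nonneg (B.nonneg _ _)]
  refine (B.le _ _).trans ?_
  have hpow : ∀ {r a M : ℝ}, 1 < r → |a| ≤ M → |a| ^ r ≤ M ^ (r - 1) * |a| := by
    intro r a M hr ha
    calc |a| ^ r = |a| ^ (r - 1) * |a| := by
          rw [← Real.rpow_add_one' (abs_nonneg a) (by linarith), sub_add_cancel]
      _ ≤ _ := by gcongr
  have hsq : ∀ {a M : ℝ}, |a| ≤ M → a ^ 2 ≤ M * |a| := fun {a M} ha => by
    rw [← sq_abs, sq]
    gcongr
  have hf := abs_gaussianAverage_le hK s x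
  have hg := abs_gaussianAverage_le hL s x
  simp only [Pi.add_apply]
  gcongr
  exacts [hpow hp hf, hpow hq hg, hsq hf, hsq hg]

/-- The second order part of the flow of `∫ b(F, G)`. -/
lemma BellmanFunction.integral_laplacian_le {p q C δ : ℝ} (B : BellmanFunction p q C δ)
    {ι : Type*} [Fintype ι] (v : OrthonormalBasis ι ℝ E) (j k : ι) (f g : 𝓢(E, ℝ)) (s : ℝ) :
    (∫ x, B.fst (gaussianAverage f s x) (gaussianAverage g s x) *
          gaussianAverage (Δ f : 𝓢(E, ℝ)) s x) +
        ∫ x, B.snd (gaussianAverage f s x) (gaussianAverage g s x) *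
          gaussianAverage (Δ g : 𝓢(E, ℝ)) s x ≤
      -2 * ∫ x, gaussianAverage (∂_{v k} f : 𝓢(E, ℝ)) s x *
        gaussianAverage (∂_{v j} g : 𝓢(E, ℝ)) s x := by
  set F := gaussianAverage f s
  set G := gaussianAverage g s
  set F' : ι → E → ℝ := fun i => gaussianAverage (∂_{v i} f : 𝓢(E, ℝ)) s
  set G' : ι → E → ℝ := fun i => gaussianAverage (∂_{v i} g : 𝓢(E, ℝ)) s
  have hF : ∀ i, Continuous (F' i) := fun i => continuous_gaussianAverage _ s
  have hG : ∀ i, Continuous (G' i) := fun i => continuous_gaussianAverage _ s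
  choose M hM0 hM using fun i => (∂_{v i} f : 𝓢(E, ℝ)).exists_abs_le
  choose N hN0 hN using fun i => (∂_{v i} g : 𝓢(E, ℝ)).exists_abs_le
  have hFM : ∀ i x, |F' i x| ≤ M i := fun i => abs_gaussianAverage_le (hM i) s
  have hGN : ∀ i x, |G' i x| ≤ N i := fun i => abs_gaussianAverage_le (hN i) s
  have hc₁ := continuous_comp_gaussianAverage B.continuous_fst f g s
  have hc₂ := continuous_comp_gaussianAverage B.continuous_snd f g s
  have hc₁₁ := continuous_comp_gaussianAverage B.continuous_fstFst f g s
  have hc₁₂ := continuous_comp_gaussianAverage B.continuous_fstSnd f g s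
  have hc₂₂ := continuous_comp_gaussianAverage B.continuous_sndSnd f g s
  obtain ⟨K₁, hK₁⟩ := exists_abs_comp_gaussianAverage_le B.continuous_fst f g
  obtain ⟨K₂, hK₂⟩ := exists_abs_comp_gaussianAverage_le B.continuous_snd f g
  obtain ⟨K₁₁, hK₁₁⟩ := exists_abs_comp_gaussianAverage_le B.continuous_fstFst f g
  obtain ⟨K₁₂, hK₁₂⟩ := exists_abs_comp_gaussianAverage_le B.continuous_fstSnd f g
  obtain ⟨K₂₂, hK₂₂⟩ := exists_abs_comp_gaussianAverage_le B.continuous_sndSnd f g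
  -- the derivatives of the two coefficients
  set D₁ : ι → E → ℝ := fun i x =>
    B.fstFst (F x) (G x) * F' i x + B.fstSnd (F x) (G x) * G' i x with hD₁
  set D₂ : ι → E → ℝ := fun i x =>
    B.fstSnd (F x) (G x) * F' i x + B.sndSnd (F x) (G x) * G' i x with hD₂
  have hD₁c : ∀ i, Continuous (D₁ i) := fun i => (hc₁₁.mul (hF i)).add (hc₁₂.mul (hG i))
  have hD₂c : ∀ i, Continuous (D₂ i) := fun i => (hc₁₂.mul (hF i)).add (hc₂₂.mul (hG i))
  have hD₁b : ∀ i x, |D₁ i x| ≤ K₁₁ * M i + K₁₂ * N i := fun i x => by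
    have h₁ := (abs_nonneg _).trans (hK₁₁ s x)
    have h₂ := (abs_nonneg _).trans (hK₁₂ s x)
    refine (abs_add_le _ _).trans ?_
    rw [abs_mul, abs_mul]
    gcongr
    exacts [hK₁₁ s x, hFM i x, hK₁₂ s x, hGN i x]
  have hD₂b : ∀ i x, |D₂ i x| ≤ K₁₂ * M i + K₂₂ * N i := fun i x => by
    have h₁ := (abs_nonneg _).trans (hK₁₂ s x)
    have h₂ := (abs_nonneg _).trans (hK₂₂ s x)
    refine (abs_add_le _ _).trans ?_
    rw [abs_mul, abs_mul]
    gcongr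
    exacts [hK₁₂ s x, hFM i x, hK₂₂ s x, hGN i x]
  have hd₁ : ∀ i x, HasLineDerivAt ℝ (fun x => B.fst (F x) (G x)) (D₁ i x) x (v i) := fun i x => by
    have := B.hasDerivAt_fst (hasLineDerivAt_gaussianAverage f s (v i) x)
      (hasLineDerivAt_gaussianAverage g s (v i) x)
    simpa [HasLineDerivAt, hD₁] using this
  have hd₂ : ∀ i x, HasLineDerivAt ℝ (fun x => B.snd (F x) (G x)) (D₂ i x) x (v i) := fun i x => by
    have := B.hasDerivAt_snd (hasLineDerivAt_gaussianAverage f s (v i) x)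
      (hasLineDerivAt_gaussianAverage g s (v i) x)
    simpa [HasLineDerivAt, hD₂] using this
  have e₁ : ∫ x, B.fst (F x) (G x) * gaussianAverage (Δ f : 𝓢(E, ℝ)) s x =
      -∑ i, ∫ x, D₁ i x * F' i x := by
    simp_rw [gaussianAverage_laplacian v, Finset.mul_sum]
    rw [integral_finsetSum _ fun i _ => integrable_mul_gaussianAverage hc₁ (hK₁ s) _ s,
      ← Finset.sum_neg_distrib]
    exact Finset.sum_congr rfl fun i _ => integral_mul_gaussianAverage_lineDeriv hc₁ (hK₁ s)
      (hD₁c i) (hD₁b i) (hd₁ i) _ s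
  have e₂ : ∫ x, B.snd (F x) (G x) * gaussianAverage (Δ g : 𝓢(E, ℝ)) s x =
      -∑ i, ∫ x, D₂ i x * G' i x := by
    simp_rw [gaussianAverage_laplacian v, Finset.mul_sum]
    rw [integral_finsetSum _ fun i _ => integrable_mul_gaussianAverage hc₂ (hK₂ s) _ s,
      ← Finset.sum_neg_distrib]
    exact Finset.sum_congr rfl fun i _ => integral_mul_gaussianAverage_lineDeriv hc₂ (hK₂ s)
      (hD₂c i) (hD₂b i) (hd₂ i) _ s
  have hi₁ : ∀ i, Integrable fun x => D₁ i x * F' i x := fun i =>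
    integrable_mul_gaussianAverage (hD₁c i) (hD₁b i) _ s
  have hi₂ : ∀ i, Integrable fun x => D₂ i x * G' i x := fun i =>
    integrable_mul_gaussianAverage (hD₂c i) (hD₂b i) _ s
  have key : ∀ x, 2 * (F' k x * G' j x) ≤ ∑ i, D₁ i x * F' i x + ∑ i, D₂ i x * G' i x := by
    intro x
    obtain ⟨a, ha, h⟩ := B.hessian (F x) (G x)
    have hk : F' k x ^ 2 ≤ ∑ i, F' i x ^ 2 :=
      Finset.single_le_sum (f := fun i => F' i x ^ 2) (fun i _ => sq_nonneg _) (Finset.mem_univ k)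
    have hj : G' j x ^ 2 ≤ ∑ i, G' i x ^ 2 :=
      Finset.single_le_sum (f := fun i => G' i x ^ 2) (fun i _ => sq_nonneg _) (Finset.mem_univ j)
    have hsum : a * ∑ i, F' i x ^ 2 + a⁻¹ * ∑ i, G' i x ^ 2 ≤
        ∑ i, D₁ i x * F' i x + ∑ i, D₂ i x * G' i x := by
      rw [Finset.mul_sum, Finset.mul_sum, ← Finset.sum_add_distrib, ← Finset.sum_add_distrib]
      refine Finset.sum_le_sum fun i _ => (h (F' i x) (G' i x)).trans_eq ?_
      simp only [hD₁, hD₂]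
      ring
    have hamgm : 2 * (F' k x * G' j x) ≤ a * F' k x ^ 2 + a⁻¹ * G' j x ^ 2 := by
      have : a * F' k x ^ 2 + a⁻¹ * G' j x ^ 2 - 2 * (F' k x * G' j x) =
          a⁻¹ * (a * F' k x - G' j x) ^ 2 := by
        field_simp
        ring
      have : 0 ≤ a⁻¹ * (a * F' k x - G' j x) ^ 2 := by positivity
      linarith
    have ha' := inv_pos.2 ha
    nlinarith
  have hint := integral_mono
    ((integrable_gaussianAverage_mul_gaussianAverage (∂_{v k} f : 𝓢(E, ℝ)) (∂_{v j} g) s).const_mul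
      2) ((integrable_finsetSum _ fun i _ => hi₁ i).add
      (integrable_finsetSum _ fun i _ => hi₂ i)) key
  simp only [Pi.add_apply] at hint
  rw [integral_const_mul, integral_add (integrable_finsetSum _ fun i _ => hi₁ i)
    (integrable_finsetSum _ fun i _ => hi₂ i), integral_finsetSum _ fun i _ => hi₁ i,
    integral_finsetSum _ fun i _ => hi₂ i] at hint
  rw [e₁, e₂]
  linarith

/-- The Bellman function method: the pairing of `∂ⱼ∂ₖu` with `g` is controlled by the Bellman
function at `(Δu, g)`. -/
lemma BellmanFunction.integral_lineDeriv_lineDeriv_mul_le {p q C δ : ℝ} (hp : 1 < p) (hq : 1 < q)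
    (hC : 0 ≤ C) (hδ : 0 ≤ δ) (B : BellmanFunction p q C δ) {ι : Type*} [Fintype ι]
    (v : OrthonormalBasis ι ℝ E) (j k : ι) (u g : 𝓢(E, ℝ)) :
    ∫ x, (∂_{v j} (∂_{v k} u) : 𝓢(E, ℝ)) x * g x ≤
      ∫ x, B.toFun ((Δ u : 𝓢(E, ℝ)) x) (g x) := by
  set w : 𝓢(E, ℝ) := ∂_{v j} (∂_{v k} u) with hw
  set f : 𝓢(E, ℝ) := Δ u with hf
  have hΔw : (Δ w : 𝓢(E, ℝ)) = ∂_{v j} (∂_{v k} f) := by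
    rw [hw, SchwartzMap.laplacian_lineDerivOp, SchwartzMap.laplacian_lineDerivOp]
  set φ : ℝ → ℝ := fun s => ∫ x, gaussianAverage w s x * gaussianAverage g s x with hφ
  set M : ℝ → ℝ := fun s => ∫ x, B.toFun (gaussianAverage f s x) (gaussianAverage g s x) with hM
  set I : ℝ → ℝ := fun s => ∫ x, gaussianAverage (∂_{v k} f : 𝓢(E, ℝ)) s x *
    gaussianAverage (∂_{v j} g : 𝓢(E, ℝ)) s x with hI
  have hφ' : ∀ s, HasDerivAt φ (s / (2 * π) * (-2 * I s)) s := by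
    intro s
    have h := hasDerivAt_integral_comp_gaussianAverage (c := fun z w => z * w)
      (c₁ := fun _ w => w) (c₂ := fun z _ => z) (by fun_prop) (by fun_prop) (by fun_prop)
      (fun hf hg => by convert! hf.mul hg using 1; ring) w g s
      (integrable_gaussianAverage_mul_gaussianAverage w g s)
    convert! h using 2
    simp_rw [mul_comm (gaussianAverage g s _)]
    rw [integral_gaussianAverage_mul_laplacian w g, hΔw]
    have := integral_gaussianAverage_mul_lineDeriv (∂_{v k} f : 𝓢(E, ℝ)) g s (v j)
    simp only [hI]
    linarith
  set M' : ℝ → ℝ := fun s => (∫ x, B.fst (gaussianAverage f s x) (gaussianAverage g s x) *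
      gaussianAverage (Δ f : 𝓢(E, ℝ)) s x) +
    ∫ x, B.snd (gaussianAverage f s x) (gaussianAverage g s x) *
      gaussianAverage (Δ g : 𝓢(E, ℝ)) s x
  have hM' : ∀ s, HasDerivAt M (s / (2 * π) * M' s) s := fun s =>
    hasDerivAt_integral_comp_gaussianAverage B.continuous_toFun B.continuous_fst B.continuous_snd
      B.hasDerivAt_toFun f g s (B.integrable_comp_gaussianAverage hp hq hC hδ f g s)
  have hmono : MonotoneOn (φ - M) (Set.Ici 0) := by
    refine monotoneOn_of_deriv_nonneg (convex_Ici 0)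
      (fun s _ => ((hφ' s).sub (hM' s)).continuousAt.continuousWithinAt)
      (fun s _ => ((hφ' s).sub (hM' s)).differentiableAt.differentiableWithinAt) fun s hs => ?_
    rw [interior_Ici, Set.mem_Ioi] at hs
    rw [((hφ' s).sub (hM' s)).deriv, ← mul_sub]
    have hle := B.integral_laplacian_le v j k f g s
    exact mul_nonneg (by positivity) (sub_nonneg.2 hle)
  have hlim : Tendsto φ atTop (𝓝 0) := by
    obtain ⟨A, hA⟩ := exists_abs_gaussianAverage_lineDeriv_le (∂_{v k} u : 𝓢(E, ℝ)) (v j)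
    refine squeeze_zero_norm' (a := fun s => A / s * ∫ x, |g x|) ?_ ?_
    · filter_upwards [eventually_gt_atTop 0] with s hs
      have h0 : 0 ≤ A / s := (abs_nonneg _).trans (hA s hs 0)
      have h := norm_integral_le_of_norm_le (μ := volume)
        (f := fun x => gaussianAverage w s x * gaussianAverage g s x)
        ((integrable_gaussianAverage g s).abs.const_mul (A / s)) (ae_of_all _ fun x => by
          rw [norm_mul]
          gcongr
          · exact hA s hs x
          · exact le_rfl)
      rw [integral_const_mul] at h
      exact h.trans (mul_le_mul_of_nonneg_left (integral_abs_gaussianAverage_le g s) h0)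
    · simpa using (tendsto_const_nhds.div_atTop tendsto_id).mul_const (∫ x, |g x|)
  have hle : ∀ s ≥ 0, φ 0 - M 0 ≤ φ s := fun s hs => by
    have h := hmono (Set.mem_Ici.2 le_rfl) (Set.mem_Ici.2 hs) hs
    have h' : 0 ≤ M s := integral_nonneg fun x => B.nonneg _ _
    simp only [Pi.sub_apply] at h
    linarith
  have h0 : φ 0 - M 0 ≤ 0 := ge_of_tendsto hlim (by
    filter_upwards [eventually_ge_atTop 0] with s hs using hle s hs)
  simp only [hφ, hM, gaussianAverage_zero] at h0
  linarith

lemma SchwartzMap.integrable_abs_rpow (f : 𝓢(E, ℝ)) {p : ℝ}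
    (hp : 0 < p) : Integrable fun x => |f x| ^ p := by
  have h := (f.memLp (ENNReal.ofReal p)).integrable_norm_rpow (by simpa using hp) (by simp)
  simpa [ENNReal.toReal_ofReal hp.le] using h

lemma integral_lineDeriv_lineDeriv_mul_le {p q C : ℝ} (hp : 1 < p) (hq : 1 < q) (hC : 0 ≤ C)
    (hB : ∀ δ > 0, Nonempty (BellmanFunction p q C δ)) {ι : Type*} [Fintype ι]
    (v : OrthonormalBasis ι ℝ E) (j k : ι) (u g : 𝓢(E, ℝ)) :
    ∫ x, (∂_{v j} (∂_{v k} u) : 𝓢(E, ℝ)) x * g x ≤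
      C * ((∫ x, |(Δ u : 𝓢(E, ℝ)) x| ^ p) + ∫ x, |g x| ^ q) := by
  set f : 𝓢(E, ℝ) := Δ u
  have hfp := f.integrable_abs_rpow (zero_lt_one.trans hp)
  have hgq := g.integrable_abs_rpow (zero_lt_one.trans hq)
  have hf2 : Integrable fun x => f x ^ 2 := (f.memLp 2).integrable_sq
  have hg2 : Integrable fun x => g x ^ 2 := (g.memLp 2).integrable_sq
  have h₁ : Integrable fun x => |f x| ^ p + |g x| ^ q := hfp.add hgq
  have h₂ : Integrable fun x => f x ^ 2 + g x ^ 2 := hf2.add hg2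
  set Q : ℝ := (∫ x, f x ^ 2) + ∫ x, g x ^ 2
  have hQ : 0 ≤ Q := add_nonneg (integral_nonneg fun x => sq_nonneg _)
    (integral_nonneg fun x => sq_nonneg _)
  refine le_of_forall_pos_le_add fun ε hε => ?_
  set δ := ε / (Q + 1)
  have hδ : 0 < δ := by positivity
  obtain ⟨B⟩ := hB δ hδ
  have hi := B.integrable_comp_gaussianAverage hp hq hC hδ.le f g 0
  simp only [gaussianAverage_zero] at hi
  calc _ ≤ ∫ x, B.toFun (f x) (g x) :=
        B.integral_lineDeriv_lineDeriv_mul_le hp hq hC hδ.le v j k u g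
    _ ≤ ∫ x, (C * (|f x| ^ p + |g x| ^ q) + δ * (f x ^ 2 + g x ^ 2)) :=
        integral_mono hi ((h₁.const_mul C).add (h₂.const_mul δ)) fun x => B.le _ _
    _ = C * ((∫ x, |f x| ^ p) + ∫ x, |g x| ^ q) + δ * Q := by
        rw [integral_add (h₁.const_mul C) (h₂.const_mul δ), integral_const_mul,
          integral_const_mul, integral_add hfp hgq, integral_add hf2 hg2]
    _ ≤ _ := by
        gcongr
        rw [div_mul_eq_mul_div, _root_.div_le_iff₀ (by positivity)]
        nlinarith

/-- Testing against Schwartz functions suffices to bound an `L^p` norm. -/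
lemma SchwartzMap.integral_abs_rpow_le_of_forall {p q a A C : ℝ} (hpq : p.HolderConjugate q)
    (w : 𝓢(E, ℝ))
    (h : ∀ g : 𝓢(E, ℝ), a * ∫ x, w x * g x ≤ C * (A + ∫ x, |g x| ^ q)) :
    a * ∫ x, |w x| ^ p ≤ C * (A + ∫ x, |w x| ^ p) := by
  have hp := hpq.pos
  have hq := hpq.symm.pos
  have := hpq.ennrealOfReal
  have : Fact (1 ≤ ENNReal.ofReal p) := ⟨ENNReal.one_le_ofReal.2 hpq.lt.le⟩
  have : Fact (1 ≤ ENNReal.ofReal q) := ⟨ENNReal.one_le_ofReal.2 hpq.symm.lt.le⟩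
  have hnorm : ∀ {g : E → ℝ} (hg : MemLp g (ENNReal.ofReal q)),
      ‖hg.toLp g‖ ^ q = ∫ x, |g x| ^ q := by
    intro g hg
    rw [Lp.norm_toLp, hg.eLpNorm_eq_integral_rpow_norm (by simpa using hq) (by simp),
      ENNReal.toReal_ofReal (by positivity), ENNReal.toReal_ofReal hq.le,
      Real.rpow_inv_rpow (by positivity) hq.ne']
    simp
  set T := (ContinuousLinearMap.mul ℝ ℝ).lpPairing (volume : Measure E) (ENNReal.ofReal p)
    (ENNReal.ofReal q) (w.toLp (ENNReal.ofReal p))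
  have hT : ∀ {g : E → ℝ} (hg : MemLp g (ENNReal.ofReal q)),
      T (hg.toLp g) = ∫ x, w x * g x := by
    intro g hg
    rw [ContinuousLinearMap.lpPairing_eq_integral]
    refine integral_congr_ae ?_
    filter_upwards [w.coeFn_toLp (ENNReal.ofReal p) volume, hg.coeFn_toLp] with x h₁ h₂
    rw [h₁, h₂, ContinuousLinearMap.mul_apply']
  have hall : ∀ G : Lp ℝ (ENNReal.ofReal q) (volume : Measure E),
      a * T G ≤ C * (A + ‖G‖ ^ q) := by
    intro G
    refine (SchwartzMap.denseRange_toLpCLM (E := E) (F := ℝ) ENNReal.ofReal_ne_top).induction_on G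
      (isClosed_le (by fun_prop) ?_) fun g => ?_
    · exact continuous_const.mul (continuous_const.add
        (continuous_norm.rpow_const fun _ => Or.inr hq.le))
    · have := h g
      rwa [← hT (g.memLp _), ← hnorm (g.memLp _)] at this
  set g₀ : E → ℝ := fun x => w x * |w x| ^ (p - 2)
  have habs : ∀ x, |g₀ x| ^ q = |w x| ^ p := by
    intro x
    rcases eq_or_ne (w x) 0 with h0 | h0
    · simp [g₀, h0, Real.zero_rpow hp.ne', Real.zero_rpow hq.ne']
    · have h1 : 0 < |w x| := abs_pos.2 h0
      rw [abs_mul, abs_of_nonneg (a := |w x| ^ (p - 2)) (by positivity),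
        ← Real.rpow_one_add' h1.le (by linarith [hpq.lt]), ← Real.rpow_mul h1.le,
        show (1 + (p - 2)) * q = p by linarith [hpq.sub_one_mul_conj]]
  have hmul : ∀ x, w x * g₀ x = |w x| ^ p := by
    intro x
    rcases eq_or_ne (w x) 0 with h0 | h0
    · simp [g₀, h0, Real.zero_rpow hp.ne']
    · have h1 : 0 < |w x| := abs_pos.2 h0
      rw [← mul_assoc, ← sq, ← sq_abs, ← Real.rpow_natCast, ← Real.rpow_add h1]
      norm_num
  have hg₀ : MemLp g₀ (ENNReal.ofReal q) := by
    have hw := w.continuous.measurable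
    rw [← integrable_norm_rpow_iff (by fun_prop) (by simpa using hq) (by simp),
      ENNReal.toReal_ofReal hq.le]
    simpa [habs] using w.integrable_abs_rpow hp
  have := hall (hg₀.toLp g₀)
  rw [hT, hnorm] at this
  simpa [habs, hmul] using this

lemma exists_integral_abs_lineDeriv_lineDeriv_rpow_le {p : ℝ} (hp : 1 < p) :
    ∃ C > 0, ∀ {ι : Type*} [Fintype ι] (v : OrthonormalBasis ι ℝ E) (j k : ι) (u : 𝓢(E, ℝ)),
      ∫ x, |(∂_{v j} (∂_{v k} u) : 𝓢(E, ℝ)) x| ^ p ≤ C ^ p * ∫ x, |(Δ u : 𝓢(E, ℝ)) x| ^ p := by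
  have hpq := Real.HolderConjugate.conjExponent hp
  obtain ⟨C, hC, hB⟩ := exists_bellmanFunction hpq
  refine ⟨2 * C, by positivity, fun v j k u => ?_⟩
  have h := (∂_{v j} (∂_{v k} u) : 𝓢(E, ℝ)).integral_abs_rpow_le_of_forall hpq
    (a := 2 * C) (A := (2 * C) ^ p * ∫ x, |(Δ u : 𝓢(E, ℝ)) x| ^ p) (C := C) fun g => by
      have := integral_lineDeriv_lineDeriv_mul_le hp hpq.symm.lt hC.le hB v j k ((2 * C) • u) g
      have e₁ : ∀ x, (∂_{v j} (∂_{v k} ((2 * C) • u)) : 𝓢(E, ℝ)) x =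
          2 * C * (∂_{v j} (∂_{v k} u) : 𝓢(E, ℝ)) x := fun x => by
        simp [lineDerivOp_smul]
      have e₂ : ∀ x, |(Δ ((2 * C) • u) : 𝓢(E, ℝ)) x| ^ p =
          (2 * C) ^ p * |(Δ u : 𝓢(E, ℝ)) x| ^ p := fun x => by
        rw [← SchwartzMap.laplacianCLM_eq', map_smul, SchwartzMap.laplacianCLM_eq', smul_apply,
          smul_eq_mul, abs_mul,
          Real.mul_rpow (abs_nonneg _) (abs_nonneg _), abs_of_pos (a := 2 * C) (by positivity)]
      simp_rw [e₁, e₂, mul_assoc, integral_const_mul] at this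
      simpa [mul_assoc] using this
  nlinarith

end GaussianAverage

/-- **Schauder (Calderón–Zygmund) estimate in `L^p`.** For `p ∈ (1, ∞)` there is a
constant `C_{p,n}` such that for every Schwartz function `u` on `ℝⁿ` and all
`j₁, j₂`, `‖∂²u/∂x_{j₁}∂x_{j₂}‖_p ≤ C_{p,n} ‖Δu‖_p`, where
`Δu = ∑_j ∂²u/∂x_j²` is the Laplacian. -/
theorem schauder_estimate (n : ℕ) (p : ℝ) (hp : 1 < p) :
    ∃ C : ℝ, 0 < C ∧
      ∀ (u : SchwartzMap (EuclideanSpace ℝ (Fin n)) ℝ) (j₁ j₂ : Fin n),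
        eLpNorm
            (fun x => iteratedFDeriv ℝ 2 (⇑u) x
              ![EuclideanSpace.single j₁ 1, EuclideanSpace.single j₂ 1])
            (ENNReal.ofReal p) volume ≤
          ENNReal.ofReal C *
            eLpNorm
              (fun x => ∑ j : Fin n, iteratedFDeriv ℝ 2 (⇑u) x
                ![EuclideanSpace.single j 1, EuclideanSpace.single j 1])
              (ENNReal.ofReal p) volume := by
  open scoped SchwartzMap LineDeriv Laplacian in
  have hp0 : 0 < p := by linarith
  obtain ⟨C, hC, h⟩ := exists_integral_abs_lineDeriv_lineDeriv_rpow_le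
    (E := EuclideanSpace ℝ (Fin n)) hp
  refine ⟨C, hC, fun u j₁ j₂ => ?_⟩
  set v := EuclideanSpace.basisFun (Fin n) ℝ
  have hd : ∀ j k : Fin n, (fun x => iteratedFDeriv ℝ 2 (⇑u) x
      ![EuclideanSpace.single j 1, EuclideanSpace.single k 1]) =
      (∂_{v j} (∂_{v k} u) : 𝓢(EuclideanSpace ℝ (Fin n), ℝ)) := by
    intro j k
    ext x
    rw [← SchwartzMap.iteratedLineDerivOp_eq_iteratedFDeriv]
    simp [LineDeriv.iteratedLineDerivOp_succ_left, v]
  have hΔ : (fun x => ∑ j : Fin n, iteratedFDeriv ℝ 2 (⇑u) x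
      ![EuclideanSpace.single j 1, EuclideanSpace.single j 1]) =
      (Δ u : 𝓢(EuclideanSpace ℝ (Fin n), ℝ)) := by
    ext x
    rw [SchwartzMap.laplacian_eq_sum v, sum_apply]
    exact Finset.sum_congr rfl fun j _ => congrFun (hd j j) x
  have hnorm : ∀ f : 𝓢(EuclideanSpace ℝ (Fin n), ℝ), eLpNorm f (ENNReal.ofReal p) volume =
      ENNReal.ofReal ((∫ x, |f x| ^ p) ^ p⁻¹) := by
    intro f
    rw [(f.memLp (ENNReal.ofReal p) volume).eLpNorm_eq_integral_rpow_norm (by simpa using hp0)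
      (by simp), ENNReal.toReal_ofReal hp0.le]
    simp
  rw [hd, hΔ, hnorm, hnorm, ← ENNReal.ofReal_mul hC.le]
  apply ENNReal.ofReal_le_ofReal
  have hI : 0 ≤ ∫ x, |(Δ u : 𝓢(EuclideanSpace ℝ (Fin n), ℝ)) x| ^ p :=
    integral_nonneg fun x => by positivity
  calc _ ≤ (C ^ p * ∫ x, |(Δ u : 𝓢(EuclideanSpace ℝ (Fin n), ℝ)) x| ^ p) ^ p⁻¹ :=
        Real.rpow_le_rpow (integral_nonneg fun x => by positivity) (h v j₁ j₂ u) (by positivity)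
    _ = _ := by rw [Real.mul_rpow (by positivity) hI, Real.rpow_rpow_inv hC.le hp0.ne']
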